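/- arXiv:1602.04649 — 11 statements merged into one kernel-verified Lean document; each statement's English description precedes it below -/
import Mathlib

section
/- For every x ∈ A there exists y ∈ A such that m(y) = ℓ(x). Consequently {ℓ(x) : x ∈ A} ⊆ {m(x) : x ∈ A}. -/
open Filter Topology

theorem Homeomorph.continuous_toEquiv_zpow {X : Type*} [TopologicalSpace X] (φ : X ≃ₜ X)
    (n : ℤ) : Continuous (φ.toEquiv ^ n : Equiv.Perm X) := by
  cases n with
  | ofNat n =>
    rw [Int.ofNat_eq_natCast, zpow_natCast, ← Equiv.Perm.iterate_eq_pow]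
    exact φ.continuous.iterate n
  | negSucc n =>
    rw [zpow_negSucc, ← inv_pow, ← Equiv.Perm.iterate_eq_pow]
    exact φ.symm.continuous.iterate (n + 1)

theorem Homeomorph.zpow_apply_le_limsup_of_tendsto {X : Type*} [TopologicalSpace X]
    (φ : X ≃ₜ X) {f : X → ℝ} (hf : Continuous f) {x y : X}
    (hbdd : IsBoundedUnder (· ≤ ·) atTop fun n : ℕ => f (φ^[n] x))
    {k : ℕ → ℕ} (hk : Tendsto k atTop atTop)
    (hy : Tendsto (fun i => φ^[k i] x) atTop (𝓝 y)) (j : ℤ) :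
    f ((φ.toEquiv ^ j) y) ≤ limsup (fun n : ℕ => f (φ^[n] x)) atTop := by
  refine le_of_forall_pos_le_add fun ε hε => ?_
  have hev : ∀ᶠ n : ℕ in atTop,
      f (φ^[n] x) < limsup (fun n : ℕ => f (φ^[n] x)) atTop + ε :=
    eventually_lt_of_limsup_lt (lt_add_of_pos_right _ hε) hbdd
  refine le_of_tendsto (((hf.comp (φ.continuous_toEquiv_zpow j)).tendsto y).comp hy) ?_
  obtain ⟨N, hN⟩ := eventually_atTop.1 hev
  filter_upwards [hk.eventually_ge_atTop (N + j.natAbs)] with i hi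
  obtain ⟨m, hm⟩ := Int.eq_ofNat_of_zero_le (a := j + k i) (by omega)
  have hshift : (φ.toEquiv ^ j) (φ^[k i] x) = φ^[m] x := by
    have hiter (n : ℕ) : φ^[n] x = (φ.toEquiv ^ (n : ℤ)) x := by
      rw [zpow_natCast, ← Equiv.Perm.iterate_eq_pow]
      rfl
    rw [hiter, hiter, ← hm, zpow_add, Equiv.Perm.mul_apply]
  simp only [Function.comp_apply, hshift]
  exact (hN m (by omega)).le

theorem Homeomorph.exists_iSup_zpow_eq_limsup {X : Type*} [MetricSpace X] (φ : X ≃ₜ X)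
    {A : Set X} (hA : IsCompact A) (hφA : Set.MapsTo φ A A) {f : X → ℝ} (hf : Continuous f)
    {x : X} (hx : x ∈ A) :
    ∃ y ∈ A, (⨆ n : ℤ, f ((φ.toEquiv ^ n) y)) =
      limsup (fun n : ℕ => f (φ^[n] x)) atTop := by
  have hmem (n : ℕ) : φ^[n] x ∈ A := hφA.iterate n hx
  obtain ⟨b, hb⟩ := hA.bddAbove_image hf.continuousOn
  obtain ⟨c, hc⟩ := hA.bddBelow_image hf.continuousOn
  have hub : IsBoundedUnder (· ≤ ·) atTop fun n : ℕ => f (φ^[n] x) :=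
    isBoundedUnder_of ⟨b, fun n => hb ⟨_, hmem n, rfl⟩⟩
  have hlb : IsBoundedUnder (· ≥ ·) atTop fun n : ℕ => f (φ^[n] x) :=
    isBoundedUnder_of ⟨c, fun n => hc ⟨_, hmem n, rfl⟩⟩
  obtain ⟨k, hk, hkL⟩ := extraction_forall_of_frequently
    (P := fun i n => limsup (fun n : ℕ => f (φ^[n] x)) atTop - 1 / ((i : ℝ) + 1) < f (φ^[n] x))
    fun i => frequently_lt_of_lt_limsup hlb.isCoboundedUnder_le
      (sub_lt_self _ Nat.one_div_pos_of_nat)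
  obtain ⟨y, hyA, s, hs, hy⟩ := hA.tendsto_subseq fun i => hmem (k i)
  have hle := φ.zpow_apply_le_limsup_of_tendsto hf hub
    (hk.tendsto_atTop.comp hs.tendsto_atTop) hy
  refine ⟨y, hyA, le_antisymm (ciSup_le hle) ?_⟩
  have hLy : limsup (fun n : ℕ => f (φ^[n] x)) atTop ≤ f y := by
    refine le_of_tendsto_of_tendsto' ?_ ((hf.tendsto y).comp hy) fun i => (hkL (s i)).le
    simpa [Function.comp_def] using (tendsto_const_nhds.sub
      (tendsto_one_div_add_atTop_nhds_zero_nat (𝕜 := ℝ))).comp hs.tendsto_atTop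
  exact hLy.trans (le_ciSup_of_le ⟨_, Set.forall_mem_range.2 hle⟩ 0 (by simp))

/-- Let `X` be a metric space, `φ : X → X` a homeomorphism, `A ⊆ X` compact
with `φ(A) = A`, and `f : X → ℝ` continuous. With `m(x) := sup_{n ∈ ℤ} f(φⁿ x)` and
`ℓ(x) := limsup_{n → +∞} f(φⁿ x)`: for every `x ∈ A` there is `y ∈ A` with `m(y) = ℓ(x)`.
Consequently `{ℓ(x) : x ∈ A} ⊆ {m(x) : x ∈ A}`. -/
theorem stmt_1 {X : Type*} [MetricSpace X] (φ : X ≃ₜ X) (A : Set X)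
    (hA : IsCompact A) (hφA : φ '' A = A) (f : X → ℝ) (hf : Continuous f) :
    (∀ x ∈ A, ∃ y ∈ A,
      (⨆ n : ℤ, f ((φ.toEquiv ^ n) y)) =
        Filter.limsup (fun n : ℕ => f ((⇑φ)^[n] x)) Filter.atTop) ∧
    {l : ℝ | ∃ x ∈ A, l = Filter.limsup (fun n : ℕ => f ((⇑φ)^[n] x)) Filter.atTop} ⊆
      {s : ℝ | ∃ x ∈ A, s = ⨆ n : ℤ, f ((φ.toEquiv ^ n) x)} := by
  have key := fun x (hx : x ∈ A) =>
    φ.exists_iSup_zpow_eq_limsup hA (Set.mapsTo_iff_image_subset.2 hφA.subset) hf hx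
  refine ⟨key, ?_⟩
  rintro l ⟨x, hx, rfl⟩
  obtain ⟨y, hy, h⟩ := key x hx
  exact ⟨y, hy, h.symm⟩
end

section
/- Let C ≥ 1 be a real number, t₀ ∈ ℝ, and N : ℝ → ℕ → ℕ with N(t, m) ≥ 1 for all t and m. Assume: (i) N(s, m) ≤ N(t, m) whenever s ≤ t; and (ii) for every m ≥ 1 there exists t > t₀ with N(t, m) = N(t₀, m). Define D(t) := inf_{m ≥ 1} (log(C · N(t, m)))/m. Then D is upper semicontinuous at t₀: for every η > 0 there exists t₁ > t₀ such that D(t) ≤ D(t₀) + η for all t ≤ t₁. -/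
/-- Let `C ≥ 1` be real, `t₀ ∈ ℝ`, and `N : ℝ → ℕ → ℕ` with `N t m ≥ 1`.
Assume `N` is monotone in `t` and for every `m ≥ 1` there is `t > t₀` with `N t m = N t₀ m`.
With `D t := inf_{m ≥ 1} log (C * N t m) / m`, the function `D` is upper semicontinuous at
`t₀`: for every `η > 0` there exists `t₁ > t₀` such that `D t ≤ D t₀ + η` for all `t ≤ t₁`. -/
theorem stmt_4 (C : ℝ) (hC : 1 ≤ C) (t₀ : ℝ) (N : ℝ → ℕ → ℕ)
    (hN : ∀ t m, 1 ≤ N t m)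
    (hmono : ∀ s t : ℝ, s ≤ t → ∀ m, N s m ≤ N t m)
    (happrox : ∀ m, 1 ≤ m → ∃ t, t₀ < t ∧ N t m = N t₀ m)
    (D : ℝ → ℝ)
    (hD : ∀ t, D t = ⨅ m : {m : ℕ // 1 ≤ m}, Real.log (C * (N t m.1 : ℝ)) / (m.1 : ℝ)) :
    ∀ η : ℝ, 0 < η → ∃ t₁, t₀ < t₁ ∧ ∀ t ≤ t₁, D t ≤ D t₀ + η := by
  intro η hη
  have : Nonempty {m : ℕ // 1 ≤ m} := ⟨⟨1, le_rfl⟩⟩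
  have hpos (t : ℝ) (m : ℕ) : 1 ≤ C * (N t m : ℝ) :=
    one_le_mul_of_one_le_of_one_le hC (by exact_mod_cast hN t m)
  have hbdd (t : ℝ) : BddBelow (Set.range fun m : {m : ℕ // 1 ≤ m} =>
      Real.log (C * (N t m.1 : ℝ)) / (m.1 : ℝ)) := by
    refine ⟨0, ?_⟩
    rintro _ ⟨m, rfl⟩
    exact div_nonneg (Real.log_nonneg (hpos t m)) (Nat.cast_nonneg _)
  have hlt : D t₀ < D t₀ + η := lt_add_of_pos_right _ hη
  nth_rewrite 1 [hD t₀] at hlt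
  obtain ⟨⟨m, hm⟩, hmlt⟩ := exists_lt_of_ciInf_lt hlt
  obtain ⟨t₁, ht₁, heq⟩ := happrox m hm
  refine ⟨t₁, ht₁, fun t ht => ?_⟩
  calc D t ≤ Real.log (C * (N t m : ℝ)) / (m : ℝ) := by
        rw [hD t]
        exact ciInf_le (hbdd t) ⟨m, hm⟩
    _ ≤ Real.log (C * (N t₀ m : ℝ)) / (m : ℝ) := by
        have hle : (N t m : ℝ) ≤ N t₀ m := by exact_mod_cast heq ▸ hmono t t₁ ht m
        have hCt := hpos t m
        gcongr
    _ ≤ D t₀ + η := hmlt.le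
end

section
/- Let 0 < d < 1, C > 0 and 0 < ε ≤ 1. Then there exists δ₀ > 0 such that for every δ with 0 < δ < δ₀ and every finite set W of unit vectors in the Euclidean plane with #W ≤ δ^{−d}, there exists a vector v with ‖v‖ ≤ ε and |⟨v, w⟩| > C·δ for every w ∈ W. -/
open scoped RealInnerProductSpace

/-- Two vectors on a common vertical line of abscissa `a`, whose heights in `[0, a]` differ by at
least `5 * η`, cannot both be `η`-close to the orthogonal complement of a unit vector `(x, y)`. -/
theorem false_of_abs_le_of_abs_le {a η s t x y : ℝ} (hη : 0 < η) (hηa : 5 * η < a)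
    (hxy : x ^ 2 + y ^ 2 = 1) (ht0 : 0 ≤ t) (hta : t ≤ a) (hst : 5 * η ≤ |s - t|)
    (hs : |a * x + s * y| ≤ η) (ht : |a * x + t * y| ≤ η) : False := by
  have ha : 0 < a := by linarith
  have hdiff : |s - t| * |y| ≤ 2 * η := by
    rw [← abs_mul]
    calc |(s - t) * y| = |(a * x + s * y) - (a * x + t * y)| := by ring_nf
      _ ≤ |a * x + s * y| + |a * x + t * y| := abs_sub _ _
      _ ≤ 2 * η := by linarith
  have hy : |y| ≤ 2 / 5 := by
    by_contra! h
    nlinarith [mul_le_mul_of_nonneg_right hst (abs_nonneg y)]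
  have hx : 9 / 10 ≤ |x| := by
    by_contra! h
    nlinarith [sq_abs x, sq_abs y, abs_nonneg x, abs_nonneg y]
  have hty : t * |y| ≤ a * (2 / 5) := mul_le_mul hta hy (abs_nonneg y) ha.le
  have hax : a * |x| ≤ η + t * |y| := by
    calc a * |x| = |(a * x + t * y) - t * y| := by
          rw [add_sub_cancel_right, abs_mul, abs_of_pos ha]
      _ ≤ |a * x + t * y| + |t * y| := abs_sub _ _
      _ ≤ η + t * |y| := by rw [abs_mul t y, abs_of_nonneg ht0]; linarith
  nlinarith [mul_le_mul_of_nonneg_left hx ha.le]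

/-- A finite set `W` of unit vectors in the plane with `10 * η * #W ≤ ε` admits a vector of norm at
most `ε` whose inner product with each element of `W` exceeds `η` in absolute value. -/
theorem exists_norm_le_forall_lt_abs_inner {η ε : ℝ} (hη : 0 < η) (hηε : 10 * η < ε)
    (W : Finset (EuclideanSpace ℝ (Fin 2))) (hW : ∀ w ∈ W, ‖w‖ = 1)
    (hcard : 10 * η * W.card ≤ ε) :
    ∃ v : EuclideanSpace ℝ (Fin 2), ‖v‖ ≤ ε ∧ ∀ w ∈ W, η < |⟪v, w⟫| := by
  have hε : 0 < ε := by linarith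
  have hheight : ∀ k ∈ Finset.range (W.card + 1), 5 * η * (k : ℝ) ≤ ε / 2 := by
    intro k hk
    have hk' : (k : ℝ) ≤ W.card := by
      exact_mod_cast Nat.lt_succ_iff.mp (Finset.mem_range.mp hk)
    nlinarith
  by_contra! hbad
  have hnear : ∀ k ∈ Finset.range (W.card + 1),
      ∃ w ∈ W, |ε / 2 * w 0 + 5 * η * (k : ℝ) * w 1| ≤ η := by
    intro k hk
    obtain ⟨w, hw, hle⟩ := hbad !₂[ε / 2, 5 * η * (k : ℝ)] (by
      have h0 : 0 ≤ 5 * η * (k : ℝ) := by positivity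
      rw [EuclideanSpace.norm_eq, Real.sqrt_le_left hε.le]
      simp only [Fin.sum_univ_two, Real.norm_eq_abs, sq_abs]
      simp only [Matrix.cons_val_zero, Matrix.cons_val_one]
      nlinarith [hheight k hk])
    refine ⟨w, hw, ?_⟩
    simpa [PiLp.inner_apply, Fin.sum_univ_two, mul_comm] using hle
  choose! f hfW hf using hnear
  obtain ⟨j, hj, k, hk, hjk, hfjk⟩ :=
    Finset.exists_ne_map_eq_of_card_lt_of_maps_to (s := Finset.range (W.card + 1)) (t := W)
      (by simp) (f := f) hfW
  have hunit : f k 0 ^ 2 + f k 1 ^ 2 = 1 := by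
    have h := EuclideanSpace.norm_sq_eq (f k)
    rw [hW _ (hfW k hk)] at h
    simpa [Fin.sum_univ_two] using h.symm
  have hsep : 5 * η ≤ |5 * η * (j : ℝ) - 5 * η * (k : ℝ)| := by
    have h : (1 : ℝ) ≤ |(j : ℝ) - k| := by
      exact_mod_cast Int.one_le_abs (sub_ne_zero.mpr (Nat.cast_injective.ne hjk : (j : ℤ) ≠ k))
    rw [← mul_sub, abs_mul, abs_of_pos (by positivity : 0 < 5 * η)]
    nlinarith
  exact false_of_abs_le_of_abs_le hη (by linarith) hunit (by positivity) (hheight k hk) hsep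
    (hfjk ▸ hf j hj) (hf k hk)

/-- Let `0 < d < 1`, `C > 0` and `0 < ε ≤ 1`. Then there is `δ₀ > 0` such that
for every `0 < δ < δ₀` and every finite set `W` of unit vectors in the Euclidean plane with
`#W ≤ δ^{-d}`, there exists `v` with `‖v‖ ≤ ε` and `|⟨v, w⟩| > C·δ` for every `w ∈ W`. -/
theorem stmt_6 (d C ε : ℝ) (hd0 : 0 < d) (hd1 : d < 1) (hC : 0 < C)
    (hε0 : 0 < ε) (hε1 : ε ≤ 1) :
    ∃ δ₀ > 0, ∀ δ : ℝ, 0 < δ → δ < δ₀ →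
      ∀ W : Finset (EuclideanSpace ℝ (Fin 2)),
        (∀ w ∈ W, ‖w‖ = 1) → (W.card : ℝ) ≤ δ ^ (-d) →
        ∃ v : EuclideanSpace ℝ (Fin 2), ‖v‖ ≤ ε ∧ ∀ w ∈ W, C * δ < |⟪v, w⟫| := by
  have hd : 0 < 1 - d := by linarith
  refine ⟨min 1 ((ε / (10 * C)) ^ (1 - d)⁻¹), by positivity, ?_⟩
  intro δ hδ hδ₀ W hW hcard
  have hδ1 : δ < 1 := hδ₀.trans_le (min_le_left _ _)
  have hpow : δ ^ (1 - d) < ε / (10 * C) :=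
    (Real.lt_rpow_inv_iff_of_pos hδ.le (by positivity) hd).mp (hδ₀.trans_le (min_le_right _ _))
  rw [lt_div_iff₀ (by positivity)] at hpow
  have hle : δ ≤ δ ^ (1 - d) := Real.self_le_rpow_of_le_one hδ.le hδ1.le (by linarith)
  have hmul : δ * W.card ≤ δ ^ (1 - d) := by
    rw [sub_eq_add_neg, Real.rpow_add hδ, Real.rpow_one]
    exact mul_le_mul_of_nonneg_left hcard hδ.le
  exact exists_norm_le_forall_lt_abs_inner (by positivity) (by nlinarith) W hW (by nlinarith)
end

section
/- Let S ⊆ Fin k. Then the number of words β ∈ B such that every position j ∈ S is right-bad for β is at most 2^{#S} · (#A)^{k − #S}. -/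
/-- Fix a finite alphabet `A`, `k ∈ ℕ`, a finite set `B` of words
`β : Fin k → A` and a linear order `<ᵤ` on `A`. A position `j` is *right-good* for `β ∈ B`
if there are `γ, γ' ∈ B` agreeing with `β` at all positions `i < j` with
`γ j <ᵤ β j <ᵤ γ' j`; otherwise it is *right-bad*. For any `S ⊆ Fin k`, the number of words
`β ∈ B` all of whose positions in `S` are right-bad is at most `2^#S * (#A)^(k - #S)`. -/
theorem stmt_7 {A : Type*} [Fintype A] (lu : LinearOrder A) (k : ℕ)
    (B : Finset (Fin k → A)) (S : Finset (Fin k)) :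
    letI := lu
    (B.filter fun β => ∀ j ∈ S,
        ¬ ∃ γ ∈ B, ∃ γ' ∈ B, (∀ i, i < j → γ i = β i ∧ γ' i = β i) ∧
            γ j < β j ∧ β j < γ' j).card
      ≤ 2 ^ S.card * Fintype.card A ^ (k - S.card) := by
  classical
  let := lu
  let f : (Fin k → A) → ({j // j ∈ S} → Prop) × ({j // j ∉ S} → A) := fun β =>
    (fun j => ∀ γ ∈ B, (∀ i, i < j.1 → γ i = β i) → β j.1 ≤ γ j.1, fun j => β j.1)
  have card_codomain : (Finset.univ : Finset (({j // j ∈ S} → Prop) × ({j // j ∉ S} → A))).card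
      = 2 ^ S.card * Fintype.card A ^ (k - S.card) := by
    simp [Finset.card_univ, Fintype.card_subtype_compl]
  rw [← card_codomain]
  refine Finset.card_le_card_of_injOn f (fun _ _ => Finset.mem_coe.2 (Finset.mem_univ _)) ?_
  intro β hβ β' hβ' h
  obtain ⟨hB, hbad⟩ := Finset.mem_filter.1 (Finset.mem_coe.1 hβ)
  obtain ⟨hB', hbad'⟩ := Finset.mem_filter.1 (Finset.mem_coe.1 hβ')
  funext j
  induction j using WellFoundedLT.induction with
  | ind j ih =>
    by_cases hj : j ∈ S
    · have hmin := congrFun (congrArg Prod.fst h) ⟨j, hj⟩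
      simp only [f, eq_iff_iff] at hmin
      by_cases hm : ∀ γ ∈ B, (∀ i, i < j → γ i = β i) → β j ≤ γ j
      · exact le_antisymm (hm β' hB' fun i hi => (ih i hi).symm)
          (hmin.1 hm β hB fun i hi => ih i hi)
      · have hm' := mt hmin.2 hm
        push Not at hm hm'
        obtain ⟨γ, hγ, hγβ, hlt⟩ := hm
        obtain ⟨γ', hγ', hγβ', hlt'⟩ := hm'
        refine le_antisymm (not_lt.1 fun hgt => ?_) (not_lt.1 fun hgt => ?_)
        · exact hbad' j hj ⟨γ', hγ', β, hB, fun i hi => ⟨hγβ' i hi, ih i hi⟩, hlt', hgt⟩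
        · exact hbad j hj ⟨γ, hγ, β', hB', fun i hi => ⟨hγβ i hi, (ih i hi).symm⟩, hlt, hgt⟩
    · exact congrFun (congrArg Prod.snd h) ⟨j, hj⟩
end

section
/- For every m ≤ k, the number of words β ∈ B having at least m right-bad positions is at most 2^k · 2^m · (#A)^{k − m}. -/
/-- The words of `B` all of whose positions in `S` are right-bad number at most
`2 ^ #S * (#A) ^ (k - #S)`: such a word is determined by its letters outside `S` together with,
for each `j ∈ S`, the information whether `β j` is minimal among the continuations in `B` of the
prefix of `β` before `j`. -/
theorem card_le_of_forall_mem_rightBad {A : Type*} [Fintype A] [LinearOrder A] {k : ℕ}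
    (B F : Finset (Fin k → A)) (S : Finset (Fin k)) (hFB : F ⊆ B)
    (hF : ∀ β ∈ F, ∀ j ∈ S, ¬ ∃ γ ∈ B, ∃ γ' ∈ B, (∀ i, i < j → γ i = β i ∧ γ' i = β i) ∧
      γ j < β j ∧ β j < γ' j) :
    F.card ≤ 2 ^ S.card * Fintype.card A ^ (k - S.card) := by
  classical
  let smaller (β : Fin k → A) (j : Fin k) : Prop :=
    ∃ γ ∈ B, (∀ i, i < j → γ i = β i) ∧ γ j < β j
  have not_apply_lt : ∀ β ∈ F, ∀ β' ∈ F, ∀ j ∈ S, (∀ i, i < j → β i = β' i) →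
      (smaller β j ↔ smaller β' j) → ¬ β j < β' j := by
    intro β hβ β' hβ' j hj hpre hbit hlt
    obtain ⟨γ, hγ, hγpre, hγlt⟩ := hbit.2 ⟨β, hFB hβ, hpre, hlt⟩
    exact hF β hβ j hj
      ⟨γ, hγ, β', hFB hβ', fun i hi => ⟨hγpre i hi, (hpre i hi).symm⟩, hγlt, hlt⟩
  let code (β : Fin k → A) : (S → Bool) × ({j // j ∉ S} → A) :=
    (fun j => decide (smaller β j), fun j => β j)
  have code_injOn : Set.InjOn code F := by
    intro β hβ β' hβ' h
    obtain ⟨hbits, hletters⟩ := Prod.ext_iff.1 h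
    funext j
    induction j using WellFoundedLT.induction with
    | ind j ih =>
      by_cases hj : j ∈ S
      · have hbit : smaller β j ↔ smaller β' j := by
          simpa [code] using congrFun hbits ⟨j, hj⟩
        exact le_antisymm
          (not_lt.1 (not_apply_lt β' hβ' β hβ j hj (fun i hi => (ih i hi).symm) hbit.symm))
          (not_lt.1 (not_apply_lt β hβ β' hβ' j hj ih hbit))
      · exact congrFun hletters ⟨j, hj⟩
  calc F.card ≤ (Finset.univ : Finset ((S → Bool) × ({j // j ∉ S} → A))).card :=
        Finset.card_le_card_of_injOn code (fun _ _ => Finset.mem_univ _) code_injOn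
    _ = 2 ^ S.card * Fintype.card A ^ (k - S.card) := by
        simp [Fintype.card_subtype_compl]


/-- Fix a finite alphabet `A`, `k ∈ ℕ`, a finite set `B` of words
`β : Fin k → A` and a linear order `<ᵤ` on `A`. A position `j` is *right-good* for `β ∈ B`
if there are `γ, γ' ∈ B` agreeing with `β` at all positions `i < j` with
`γ j <ᵤ β j <ᵤ γ' j`; otherwise it is *right-bad*. For every `m ≤ k`, the number of words
`β ∈ B` having at least `m` right-bad positions is at most `2^k * 2^m * (#A)^(k - m)`. -/
theorem stmt_8 {A : Type*} [Fintype A] (lu : LinearOrder A) (k : ℕ)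
    (B : Finset (Fin k → A)) (m : ℕ) (hm : m ≤ k) :
    letI := lu
    (B.filter fun β => m ≤ (Finset.univ.filter fun j : Fin k =>
        ¬ ∃ γ ∈ B, ∃ γ' ∈ B, (∀ i, i < j → γ i = β i ∧ γ' i = β i) ∧
            γ j < β j ∧ β j < γ' j).card).card
      ≤ 2 ^ k * 2 ^ m * Fintype.card A ^ (k - m) := by
  classical
  let := lu
  let bad (β : Fin k → A) (j : Fin k) : Prop :=
    ¬ ∃ γ ∈ B, ∃ γ' ∈ B, (∀ i, i < j → γ i = β i ∧ γ' i = β i) ∧ γ j < β j ∧ β j < γ' j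
  let allBad (S : Finset (Fin k)) : Finset (Fin k → A) := B.filter fun β => ∀ j ∈ S, bad β j
  have card_allBad : ∀ S ∈ Finset.powersetCard m Finset.univ,
      (allBad S).card ≤ 2 ^ m * Fintype.card A ^ (k - m) := by
    intro S hS
    have h := card_le_of_forall_mem_rightBad B (allBad S) S (Finset.filter_subset _ _)
      fun β hβ => (Finset.mem_filter.1 hβ).2
    rwa [(Finset.mem_powersetCard.1 hS).2] at h
  calc _ ≤ ((Finset.powersetCard m Finset.univ).biUnion allBad).card := by
        refine Finset.card_le_card fun β hβ => ?_
        obtain ⟨hβB, hβm⟩ := Finset.mem_filter.1 hβ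
        obtain ⟨S, hS, hSm⟩ := Finset.exists_subset_card_eq hβm
        refine Finset.mem_biUnion.2
          ⟨S, Finset.mem_powersetCard.2 ⟨Finset.subset_univ S, hSm⟩, ?_⟩
        exact Finset.mem_filter.2 ⟨hβB, fun j hj => (Finset.mem_filter.1 (hS hj)).2⟩
    _ ≤ (Finset.powersetCard m (Finset.univ : Finset (Fin k))).card *
          (2 ^ m * Fintype.card A ^ (k - m)) := Finset.card_biUnion_le_card_mul _ _ _ card_allBad
    _ ≤ 2 ^ k * (2 ^ m * Fintype.card A ^ (k - m)) := by
        gcongr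
        simpa using Nat.choose_le_two_pow k m
    _ = 2 ^ k * 2 ^ m * Fintype.card A ^ (k - m) := (mul_assoc _ _ _).symm
end

section
/- Assume k is divisible by 20. Then the number of words β ∈ B for which at least 9k/10 positions j ∈ Fin k are good for β is at least #B − 2 · 2^{21k/20} · (#A)^{19k/20}. -/
open scoped Classical

/-- `j` is good for `β` relative to a relation `r` on positions: among the words of `B` agreeing
with `β` on all positions `r`-below `j`, one is smaller and one is larger than `β` at `j`. -/
def IsGoodAt {ι A : Type*} (r : ι → ι → Prop) (l : LinearOrder A) (B : Finset (ι → A))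
    (β : ι → A) (j : ι) : Prop :=
  ∃ γ ∈ B, ∃ γ' ∈ B, (∀ i, r i j → γ i = β i ∧ γ' i = β i) ∧ l.lt (γ j) (β j) ∧ l.lt (β j) (γ' j)

/-- A word is determined by its letters outside `S` and one bit for each position of `S`,
provided all positions of `S` are bad for it. -/
lemma card_filter_forall_not_isGoodAt_le {ι A : Type*} [Fintype ι] [Fintype A]
    {r : ι → ι → Prop} (hr : WellFounded r) (l : LinearOrder A) (B : Finset (ι → A))
    (S : Finset ι) :
    (B.filter fun β => ∀ j ∈ S, ¬ IsGoodAt r l B β j).card ≤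
      2 ^ S.card * Fintype.card A ^ (Fintype.card ι - S.card) := by
  let code : (ι → A) → (S → Prop) × ({j // j ∉ S} → A) := fun β =>
    (fun j => ∃ γ ∈ B, (∀ i, r i j → γ i = β i) ∧ γ j < β j, fun j => β j)
  have hinj : Set.InjOn code (B.filter fun β => ∀ j ∈ S, ¬ IsGoodAt r l B β j) := by
    intro β hβ β' hβ' h
    simp only [Finset.coe_filter, Set.mem_ofPred_eq] at hβ hβ'
    obtain ⟨h₁, h₂⟩ := Prod.ext_iff.1 h
    funext j
    induction j using hr.induction with
    | _ j ih =>
      by_cases hj : j ∈ S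
      · have hbit : (∃ γ ∈ B, (∀ i, r i j → γ i = β i) ∧ γ j < β j) ↔
            ∃ γ ∈ B, (∀ i, r i j → γ i = β' i) ∧ γ j < β' j := iff_of_eq (congrFun h₁ ⟨j, hj⟩)
        rcases lt_trichotomy (β j) (β' j) with hlt | heq | hlt
        · obtain ⟨γ, hγ, hγβ, hγj⟩ := hbit.2 ⟨β, hβ.1, ih, hlt⟩
          exact (hβ.2 j hj ⟨γ, hγ, β', hβ'.1, fun i hi => ⟨hγβ i hi, (ih i hi).symm⟩,
            hγj, hlt⟩).elim
        · exact heq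
        · obtain ⟨γ, hγ, hγβ, hγj⟩ := hbit.1 ⟨β', hβ'.1, fun i hi => (ih i hi).symm, hlt⟩
          exact (hβ'.2 j hj ⟨γ, hγ, β, hβ.1, fun i hi => ⟨hγβ i hi, ih i hi⟩, hγj, hlt⟩).elim
      · exact congrFun h₂ ⟨j, hj⟩
  have hcard := Finset.card_le_card_of_injOn (t := Finset.univ) code
    (fun _ _ => Finset.mem_coe.2 (Finset.mem_univ _)) hinj
  have hcompl : Fintype.card {j // j ∉ S} = Fintype.card ι - S.card := by
    rw [Fintype.card_subtype_compl, Fintype.card_coe]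
  simpa [Finset.card_univ, Fintype.card_prod, Fintype.card_fun, hcompl] using hcard

/-- Few words have at least `m` bad positions. -/
lemma card_filter_le_card_not_isGoodAt_le {ι A : Type*} [Fintype ι] [Fintype A]
    {r : ι → ι → Prop} (hr : WellFounded r) (l : LinearOrder A) (B : Finset (ι → A)) (m : ℕ) :
    (B.filter fun β => m ≤ (Finset.univ.filter fun j => ¬ IsGoodAt r l B β j).card).card ≤
      2 ^ (Fintype.card ι + m) * Fintype.card A ^ (Fintype.card ι - m) := by
  have hsub : (B.filter fun β => m ≤ (Finset.univ.filter fun j => ¬ IsGoodAt r l B β j).card) ⊆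
      (Finset.univ.powersetCard m).biUnion fun S =>
        B.filter fun β => ∀ j ∈ S, ¬ IsGoodAt r l B β j := by
    intro β hβ
    obtain ⟨hβB, hm⟩ := Finset.mem_filter.1 hβ
    obtain ⟨S, hS, rfl⟩ := Finset.exists_subset_card_eq hm
    exact Finset.mem_biUnion.2 ⟨S, Finset.mem_powersetCard.2 ⟨Finset.subset_univ S, rfl⟩,
      Finset.mem_filter.2 ⟨hβB, fun j hj => (Finset.mem_filter.1 (hS hj)).2⟩⟩
  refine (Finset.card_le_card hsub).trans ((Finset.card_biUnion_le_card_mul _ _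
    (2 ^ m * Fintype.card A ^ (Fintype.card ι - m)) fun S hS => ?_).trans ?_)
  · obtain rfl := (Finset.mem_powersetCard.1 hS).2
    exact card_filter_forall_not_isGoodAt_le hr l B S
  · rw [pow_add, mul_assoc, Finset.card_powersetCard, Finset.card_univ]
    exact Nat.mul_le_mul_right _ (Nat.choose_le_two_pow _ _)

/-- Fix a finite alphabet `A`, `k ∈ ℕ` divisible by 20, a finite set `B` of
words `β : Fin k → A`, a linear order `<ᵤ` on `A` (defining right-good positions) and a
linear order `<ₛ` on `A` (defining left-good positions). A position is *good* for `β` if it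
is both right-good and left-good for `β`. Then the number of `β ∈ B` for which at least
`9k/10` positions are good is at least `#B − 2 · 2^{21k/20} · (#A)^{19k/20}`. -/
theorem stmt_9 {A : Type*} [Fintype A] (lu ls : LinearOrder A) (k : ℕ) (hk : 20 ∣ k)
    (B : Finset (Fin k → A)) :
    (B.card : ℤ) - 2 * 2 ^ (21 * k / 20) * (Fintype.card A : ℤ) ^ (19 * k / 20) ≤
      (((B.filter fun β => 9 * k / 10 ≤ (Finset.univ.filter fun j : Fin k =>
          (∃ γ ∈ B, ∃ γ' ∈ B, (∀ i, i < j → γ i = β i ∧ γ' i = β i) ∧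
              lu.lt (γ j) (β j) ∧ lu.lt (β j) (γ' j)) ∧
          (∃ γ ∈ B, ∃ γ' ∈ B, (∀ i, j < i → γ i = β i ∧ γ' i = β i) ∧
              ls.lt (γ j) (β j) ∧ ls.lt (β j) (γ' j))).card).card : ℕ) : ℤ) := by
  obtain ⟨m, rfl⟩ := hk
  have hR := card_filter_le_card_not_isGoodAt_le (r := fun i j : Fin (20 * m) => i < j)
    wellFounded_lt lu B m
  have hL := card_filter_le_card_not_isGoodAt_le (r := fun i j : Fin (20 * m) => j < i)
    wellFounded_gt ls B m
  rw [Fintype.card_fin, show 20 * m + m = 21 * m by ring,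
    show 20 * m - m = 19 * m by omega] at hR hL
  rw [show 21 * (20 * m) / 20 = 21 * m by omega, show 19 * (20 * m) / 20 = 19 * m by omega,
    show 9 * (20 * m) / 10 = 18 * m by omega]
  have hcover : B ⊆ (B.filter fun β => 18 * m ≤ (Finset.univ.filter fun j : Fin (20 * m) =>
        IsGoodAt (fun i j => i < j) lu B β j ∧ IsGoodAt (fun i j => j < i) ls B β j).card) ∪
      ((B.filter fun β => m ≤ (Finset.univ.filter fun j : Fin (20 * m) =>
        ¬ IsGoodAt (fun i j => i < j) lu B β j).card) ∪
      (B.filter fun β => m ≤ (Finset.univ.filter fun j : Fin (20 * m) =>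
        ¬ IsGoodAt (fun i j => j < i) ls B β j).card)) := by
    intro β hβ
    have hsplit := Finset.card_filter_add_card_filter_not (s := (Finset.univ : Finset (Fin (20 * m))))
      fun j => IsGoodAt (fun i j => i < j) lu B β j ∧ IsGoodAt (fun i j => j < i) ls B β j
    have hbad := Finset.card_union_le
      (Finset.univ.filter fun j : Fin (20 * m) => ¬ IsGoodAt (fun i j => i < j) lu B β j)
      (Finset.univ.filter fun j : Fin (20 * m) => ¬ IsGoodAt (fun i j => j < i) ls B β j)
    rw [← Finset.filter_or] at hbad
    simp only [not_and_or, Finset.card_univ, Fintype.card_fin] at hsplit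
    simp only [Finset.mem_union, Finset.mem_filter, hβ, true_and]
    omega
  have hcard := (Finset.card_le_card hcover).trans ((Finset.card_union_le _ _).trans
    (Nat.add_le_add_left (Finset.card_union_le _ _) _))
  have hgood : B.card ≤ (B.filter fun β => 18 * m ≤ (Finset.univ.filter fun j : Fin (20 * m) =>
        IsGoodAt (fun i j => i < j) lu B β j ∧ IsGoodAt (fun i j => j < i) ls B β j).card).card +
      2 * (2 ^ (21 * m) * Fintype.card A ^ (19 * m)) :=
    hcard.trans (by rw [two_mul]; exact Nat.add_le_add_left (Nat.add_le_add hR hL) _)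
  rw [sub_le_iff_le_add, mul_assoc]
  convert Int.ofNat_le.2 hgood using 1
  push_cast
  congr!
end

section
/- Let k ∈ ℕ be divisible by 20 and let S ⊆ {0, 1, …, k − 1} with #S ≥ 9k/10. Then there exist integers i₁ < i₂ < ⋯ < i_{2k/5} such that i_{n+1} − i_n ≥ 2 for all 1 ≤ n < 2k/5, i_{2k/5} ≤ k − 2, and both i_n ∈ S and i_n + 1 ∈ S for every 1 ≤ n ≤ 2k/5. -/
/-- Let `k ∈ ℕ` be divisible by 20 and let `S ⊆ {0, …, k−1}` with
`#S ≥ 9k/10`. Then there are integers `i₁ < i₂ < ⋯ < i_{2k/5}` with consecutive gaps at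
least 2, with `i_{2k/5} ≤ k − 2`, and with `i_n ∈ S` and `i_n + 1 ∈ S` for every `n`. -/
theorem stmt_10 (k : ℕ) (hk : 20 ∣ k) (S : Finset ℕ) (hS : S ⊆ Finset.range k)
    (hcard : 9 * k / 10 ≤ S.card) :
    ∃ i : ℕ → ℕ,
      (∀ n, n + 1 < 2 * k / 5 → i n + 2 ≤ i (n + 1)) ∧
      (∀ n, n < 2 * k / 5 → i n ≤ k - 2) ∧
      (∀ n, n < 2 * k / 5 → i n ∈ S ∧ i n + 1 ∈ S) := by
  obtain ⟨m, rfl⟩ := hk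
  set T := (Finset.range (10 * m)).filter (fun j => 2 * j ∈ S ∧ 2 * j + 1 ∈ S) with hT
  have hbad : Finset.range (10 * m) \ T ⊆ (Finset.range (20 * m) \ S).image (· / 2) := by
    intro j hj
    simp only [hT, Finset.mem_sdiff, Finset.mem_filter, Finset.mem_range, not_and] at hj
    simp only [Finset.mem_image, Finset.mem_sdiff, Finset.mem_range]
    by_cases h : 2 * j ∈ S
    · exact ⟨2 * j + 1, ⟨by omega, hj.2 hj.1 h⟩, by omega⟩
    · exact ⟨2 * j, ⟨by omega, h⟩, by omega⟩
  have hsub : T ⊆ Finset.range (10 * m) := Finset.filter_subset _ _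
  have hTcard : 2 * (20 * m) / 5 ≤ T.card := by
    have h₁ := (Finset.card_le_card hbad).trans Finset.card_image_le
    have h₂ := Finset.card_le_card hS
    rw [Finset.card_sdiff_of_subset hS, Finset.card_sdiff_of_subset hsub] at h₁
    simp only [Finset.card_range] at h₁ h₂
    omega
  let e := T.orderEmbOfCardLe hTcard
  have he (n : Fin (2 * (20 * m) / 5)) : e n < 10 * m ∧ 2 * e n ∈ S ∧ 2 * e n + 1 ∈ S := by
    simpa [hT] using T.orderEmbOfCardLe_mem hTcard n
  refine ⟨fun n => if h : n < 2 * (20 * m) / 5 then 2 * e ⟨n, h⟩ else 0, ?_, ?_, ?_⟩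
  · intro n hn
    have hlt : e ⟨n, by omega⟩ < e ⟨n + 1, hn⟩ := e.strictMono (Fin.mk_lt_mk.2 n.lt_succ_self)
    simp only [dif_pos hn, dif_pos (Nat.lt_of_succ_lt hn)]
    omega
  · intro n hn
    have := (he ⟨n, hn⟩).1
    simp only [dif_pos hn]
    omega
  · intro n hn
    simpa only [dif_pos hn] using (he ⟨n, hn⟩).2
end

section
/- Let A be a finite alphabet with N₀ := #A, let k ∈ ℕ be divisible by 20, and let M, g ≥ 1 be integers with M·g ≤ 2k/5. Let G assign to every word β : Fin k → A a subset G(β) ⊆ {0, …, k − 1}, and let E be a finite set of words of length k such that #G(β) ≥ 9k/10 for every β ∈ E. Then there exist integers j₁ < ⋯ < j_M with j_{m+1} − j_m ≥ 2g for all m and j_M ≤ k − 2, and pairs (b_m, b'_m) ∈ A × A for 1 ≤ m ≤ M, such that the set X := {β ∈ E : for all 1 ≤ m ≤ M, j_m ∈ G(β), j_m + 1 ∈ G(β), β(j_m) = b_m and β(j_m + 1) = b'_m} satisfies #X ≥ #E / (2^k · N₀^{2M}). -/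
open scoped Classical

theorem Nat.nth_add_le_of_lt_card {p : ℕ → Prop} (hp : (Set.ofPred p).Finite) (n d : ℕ)
    (h : n + d < hp.toFinset.card) : Nat.nth p n + d ≤ Nat.nth p (n + d) := by
  induction d with
  | zero => simp
  | succ d ih =>
    have h₁ := ih (by omega)
    have h₂ : Nat.nth p (n + d) < Nat.nth p (n + (d + 1)) :=
      Nat.nth_lt_nth_of_lt_card hp (by omega) h
    omega

/-- A finite set of naturals with more than `d * (M - 1)` elements contains `M` points with
consecutive gaps at least `d`. -/
theorem Finset.exists_separated_seq (T : Finset ℕ) (d M : ℕ) (h : d * (M - 1) < T.card) :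
    ∃ j : ℕ → ℕ, (∀ m, m + 1 < M → j m + d ≤ j (m + 1)) ∧ ∀ m, m < M → j m ∈ T := by
  have hp : (Set.ofPred fun n => n ∈ T).Finite := T.finite_toSet
  have hcard : hp.toFinset.card = T.card := by
    congr 1
    ext
    simp
  have hlt : ∀ m, m < M → d * m < hp.toFinset.card := fun m hm =>
    hcard ▸ (Nat.mul_le_mul_left d (by omega)).trans_lt h
  refine ⟨fun m => Nat.nth (· ∈ T) (d * m), fun m hm => ?_, fun m hm => ?_⟩
  · simpa only [Nat.mul_succ] using Nat.nth_add_le_of_lt_card hp (d * m) d (hlt (m + 1) hm)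
  · exact Nat.nth_mem_of_lt_card hp (hlt m hm)

/-- A set `S ⊆ {0, …, k - 1}` contains at least `2 * #S - (k + 1)` pairs of consecutive integers. -/
theorem Finset.two_mul_card_le_card_filter_succ_mem (S : Finset ℕ) (k : ℕ)
    (hS : S ⊆ Finset.range k) :
    2 * S.card ≤ (S.filter fun n => n + 1 ∈ S).card + (k + 1) := by
  have hunion : (S ∪ S.image Nat.succ).card ≤ k + 1 := by
    refine (Finset.card_le_card fun x hx => ?_).trans_eq (Finset.card_range (k + 1))
    rcases Finset.mem_union.1 hx with h | h
    · have := Finset.mem_range.1 (hS h)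
      exact Finset.mem_range.2 (by omega)
    · obtain ⟨y, hy, rfl⟩ := Finset.mem_image.1 h
      have := Finset.mem_range.1 (hS hy)
      exact Finset.mem_range.2 (by omega)
  have hinter : (S ∩ S.image Nat.succ).card ≤ (S.filter fun n => n + 1 ∈ S).card := by
    refine (Finset.card_le_card fun x hx => ?_).trans
      (Finset.card_image_le (f := Nat.succ) (s := S.filter fun n => n + 1 ∈ S))
    obtain ⟨hxS, hx'⟩ := Finset.mem_inter.1 hx
    obtain ⟨y, hy, rfl⟩ := Finset.mem_image.1 hx'
    exact Finset.mem_image_of_mem _ (Finset.mem_filter.2 ⟨hy, hxS⟩)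
  have hsum := Finset.card_union_add_card_inter S (S.image Nat.succ)
  rw [Finset.card_image_of_injective S Nat.succ_injective] at hsum
  omega

theorem Finset.exists_separated_consecutive_pairs (k : ℕ) (hk : 20 ∣ k) (M g : ℕ) (hM : 1 ≤ M)
    (hg : 1 ≤ g) (hMg : M * g ≤ 2 * k / 5) (S : Finset ℕ) (hS : S ⊆ Finset.range k)
    (hcard : 9 * k / 10 ≤ S.card) :
    ∃ j : ℕ → ℕ, (∀ m, m + 1 < M → j m + 2 * g ≤ j (m + 1)) ∧
      ∀ m, m < M → j m ∈ S ∧ j m + 1 ∈ S := by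
  have hpairs := S.two_mul_card_le_card_filter_succ_mem k hS
  obtain ⟨j, hgap, hmem⟩ := (S.filter fun n => n + 1 ∈ S).exists_separated_seq (2 * g) M (by
    obtain ⟨t, rfl⟩ := hk
    obtain ⟨M, rfl⟩ := Nat.exists_eq_add_of_le' hM
    rw [Nat.add_mul] at hMg
    rw [Nat.add_sub_cancel, Nat.mul_assoc, Nat.mul_comm g M]
    omega)
  exact ⟨j, hgap, fun m hm => Finset.mem_filter.1 (hmem m hm)⟩

/-- Let `A` be a finite alphabet with `N₀ = #A`, `k` divisible by 20,
`M, g ≥ 1` integers with `M·g ≤ 2k/5`. Let `G` assign to each word `β : Fin k → A` a subset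
`G β ⊆ {0, …, k−1}` and let `E` be a finite set of words with `#(G β) ≥ 9k/10` for `β ∈ E`.
Then there are integers `j₁ < ⋯ < j_M` with gaps at least `2g` and `j_M ≤ k − 2`, and pairs
`(b_m, b'_m) ∈ A × A`, such that
`X := {β ∈ E : ∀ m, j_m ∈ G β, j_m + 1 ∈ G β, β (j_m) = b_m, β (j_m + 1) = b'_m}`
satisfies `#X ≥ #E / (2^k · N₀^{2M})`. -/
theorem stmt_11 {A : Type*} [Fintype A] [Nonempty A] (N₀ : ℕ) (hN₀ : N₀ = Fintype.card A)
    (k : ℕ) (hk : 20 ∣ k) (M g : ℕ) (hM : 1 ≤ M) (hg : 1 ≤ g) (hMg : M * g ≤ 2 * k / 5)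
    (G : (Fin k → A) → Finset ℕ) (hG : ∀ β, G β ⊆ Finset.range k)
    (E : Finset (Fin k → A)) (hE : ∀ β ∈ E, 9 * k / 10 ≤ (G β).card) :
    ∃ (j : ℕ → ℕ) (b b' : ℕ → A),
      (∀ m, m + 1 < M → j m + 2 * g ≤ j (m + 1)) ∧
      (∀ m, m < M → j m ≤ k - 2) ∧
      (E.card : ℝ) / (2 ^ k * (N₀ : ℝ) ^ (2 * M)) ≤
        ((E.filter fun β => ∀ m, m < M →
            j m ∈ G β ∧ j m + 1 ∈ G β ∧
            (∀ i : Fin k, ((i : ℕ) = j m → β i = b m) ∧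
              ((i : ℕ) = j m + 1 → β i = b' m))).card : ℝ) := by
  choose! j hgap hmem using
    Finset.exists_separated_consecutive_pairs k hk M g hM hg hMg
  have hkpos : 0 < k := by
    have := Nat.mul_pos hM hg
    omega
  let letter : (Fin k → A) → ℕ → A := fun β n => β ⟨n % k, Nat.mod_lt n hkpos⟩
  let pattern : (Fin k → A) → Finset ℕ × (Fin M → A × A) := fun β =>
    (G β, fun m => (letter β (j (G β) m), letter β (j (G β) m + 1)))
  let large := (Finset.range k).powerset.filter fun S => 9 * k / 10 ≤ S.card
  let patterns : Finset (Finset ℕ × (Fin M → A × A)) := large ×ˢ Finset.univ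
  have hmaps : ∀ β ∈ E, pattern β ∈ patterns := fun β hβ => by
    simp only [patterns, large, pattern, Finset.mem_product, Finset.mem_filter,
      Finset.mem_powerset, Finset.mem_univ, and_true]
    exact ⟨hG β, hE β hβ⟩
  have hne : patterns.Nonempty := by
    refine Finset.Nonempty.product ⟨Finset.range k, ?_⟩ Finset.univ_nonempty
    simp only [large, Finset.mem_filter, Finset.mem_powerset, Finset.Subset.refl, true_and,
      Finset.card_range]
    omega
  have hcard : (patterns.card : ℝ) ≤ 2 ^ k * (N₀ : ℝ) ^ (2 * M) := by
    have hlarge : large.card ≤ 2 ^ k :=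
      (Finset.card_filter_le _ _).trans_eq (by simp)
    have huniv : (Finset.univ : Finset (Fin M → A × A)).card = N₀ ^ (2 * M) := by
      simp [hN₀, pow_mul, sq]
    have : patterns.card ≤ 2 ^ k * N₀ ^ (2 * M) := by
      rw [Finset.card_product, huniv]
      exact Nat.mul_le_mul_right _ hlarge
    exact_mod_cast this
  have hpos : (0 : ℝ) < patterns.card := by exact_mod_cast hne.card_pos
  obtain ⟨⟨S, w⟩, hSw, hfiber⟩ :=
    Finset.exists_le_card_fiber_of_nsmul_le_card_of_maps_to (M := ℝ) hmaps hne
      (b := (E.card : ℝ) / (2 ^ k * (N₀ : ℝ) ^ (2 * M))) (by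
        rw [nsmul_eq_mul, mul_div_assoc', div_le_iff₀ (hpos.trans_le hcard), mul_comm]
        exact mul_le_mul_of_nonneg_left hcard (Nat.cast_nonneg _))
  obtain ⟨hS, hScard⟩ := Finset.mem_filter.1 (Finset.mem_product.1 hSw).1
  rw [Finset.mem_powerset] at hS
  let b : ℕ → A × A := fun m => if h : m < M then w ⟨m, h⟩ else Classical.arbitrary _
  refine ⟨j S, fun m => (b m).1, fun m => (b m).2, hgap S hS hScard, fun m hm => ?_,
    hfiber.trans (Nat.cast_le.2 (Finset.card_le_card fun β hβ => ?_))⟩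
  · have := Finset.mem_range.1 (hS (hmem S hS hScard m hm).2)
    omega
  · obtain ⟨hβE, hβ⟩ := Finset.mem_filter.1 hβ
    obtain ⟨hGS, hw⟩ := Prod.mk.inj hβ
    refine Finset.mem_filter.2 ⟨hβE, fun m hm => ?_⟩
    obtain ⟨hj, hj'⟩ := hmem S hS hScard m hm
    have hb : b m = (letter β (j S m), letter β (j S m + 1)) := by
      simp only [b, dif_pos hm, ← hw, hGS]
    have hletter : ∀ i : Fin k, β i = letter β i := fun i => by
      simp only [letter, Nat.mod_eq_of_lt i.isLt]
    simp only [hGS, hb]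
    exact ⟨hj, hj', fun i => ⟨fun h => by rw [hletter, h], fun h => by rw [hletter, h]⟩⟩
end

section
/- Let A be a finite alphabet with N₀ := #A ≥ 2 and let τ be a real number with 0 < τ < 1. Set k := 8·N₀²·⌈2/τ⌉ and M := 3·N₀². Let 0 ≤ j₁ < ⋯ < j_M be integers with j_{m+1} − j_m ≥ 2⌈2/τ⌉ for all m and j_M ≤ k − 2, let (b_m, b'_m) ∈ A × A for 1 ≤ m ≤ M, and let X be a finite set of words β : Fin k → A such that β(j_m) = b_m and β(j_m + 1) = b'_m for every β ∈ X and every m, and such that #X > N₀^{(1−2τ)k}. For 1 ≤ p < q ≤ M, let π_{p,q}(X) denote the image of X under the map restricting a word β to the positions i with j_p < i ≤ j_q. Then there exist 1 ≤ p₀ < q₀ ≤ M such that (b_{p₀}, b'_{p₀}) = (b_{q₀}, b'_{q₀}) and #π_{p₀,q₀}(X) > N₀^{(1−10τ)(j_{q₀} − j_{p₀})}. -/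
open scoped Classical

/-- If `g` determines `f` on `X`, then `f` takes at most as many values on `X` as `g`. -/
theorem Finset.card_image_le_card_image_of_factors {α β γ : Type*} [DecidableEq β] [DecidableEq γ]
    (X : Finset α) (f : α → β) (g : α → γ)
    (h : ∀ x ∈ X, ∀ y ∈ X, g x = g y → f x = f y) :
    (X.image f).card ≤ (X.image g).card := by
  obtain rfl | ⟨x₀, -⟩ := X.eq_empty_or_nonempty
  · simp
  have : Nonempty α := ⟨x₀⟩
  have hpre : ∀ y ∈ X.image f, ∃ x ∈ X, f x = y := fun y hy => by simpa using hy
  choose! s hsX hsf using hpre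
  refine Finset.card_le_card_of_injOn (fun y => g (s y))
    (fun y hy => Finset.mem_image_of_mem g (hsX y hy)) fun y hy z hz hyz => ?_
  rw [← hsf y hy, ← hsf z hz]
  exact h _ (hsX y hy) _ (hsX z hz) hyz

/-- The number of restrictions to the positions satisfying `P` of the words in `X`. -/
noncomputable def restrictionCount {ι A : Type*} [Fintype ι] (X : Finset (ι → A))
    (P : ι → Prop) : ℕ :=
  (X.image fun β => fun i : {i // P i} => β i.1).card

section restrictionCount

variable {ι A : Type*} [Fintype ι] (X : Finset (ι → A))

theorem restrictionCount_le_mul {P Q R : ι → Prop} (h : ∀ i, P i → Q i ∨ R i) :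
    restrictionCount X P ≤ restrictionCount X Q * restrictionCount X R := by
  unfold restrictionCount
  rw [← Finset.card_product]
  refine (Finset.card_image_le_card_image_of_factors X _ (fun β =>
    ((fun i : {i // Q i} => β i.1), (fun i : {i // R i} => β i.1))) ?_).trans
    (Finset.card_le_card ?_)
  · intro x _ y _ hxy
    rw [Prod.mk.injEq] at hxy
    funext ⟨i, hi⟩
    rcases h i hi with hi | hi
    · exact congrFun hxy.1 ⟨i, hi⟩
    · exact congrFun hxy.2 ⟨i, hi⟩
  · intro z hz
    obtain ⟨β, hβ, rfl⟩ := Finset.mem_image.1 hz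
    exact Finset.mem_product.2
      ⟨Finset.mem_image_of_mem _ hβ, Finset.mem_image_of_mem _ hβ⟩

theorem card_le_restrictionCount {P : ι → Prop} (h : ∀ i, P i) :
    X.card ≤ restrictionCount X P := by
  refine (Finset.card_image_of_injective X fun x y hxy => ?_).ge
  funext i
  exact congrFun hxy ⟨i, h i⟩

end restrictionCount

theorem restrictionCount_le_pow {A : Type*} [Fintype A] [Nonempty A] {k : ℕ}
    (X : Finset (Fin k → A)) {P : Fin k → Prop} {a b : ℕ}
    (h : ∀ i, P i → a ≤ (i : ℕ) ∧ (i : ℕ) < b) :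
    restrictionCount X P ≤ Fintype.card A ^ (b - a) := by
  have hP : Fintype.card {i // P i} ≤ b - a := by
    have := Fintype.card_le_of_injective
      (fun i : {i // P i} => (⟨i.1, Finset.mem_Ico.2 (h i.1 i.2)⟩ : Finset.Ico a b))
      fun x y hxy => Subtype.ext (Fin.ext (congrArg Subtype.val hxy))
    simpa using this
  calc restrictionCount X P ≤ Fintype.card ({i // P i} → A) := Finset.card_le_univ _
    _ = Fintype.card A ^ Fintype.card {i // P i} := Fintype.card_fun
    _ ≤ _ := Nat.pow_le_pow_right Fintype.card_pos hP

theorem add_mul_le_of_gaps {j : ℕ → ℕ} {M g : ℕ}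
    (hgap : ∀ m, m + 1 < M → j m + g ≤ j (m + 1)) {p q : ℕ} (hpq : p ≤ q) (hq : q < M) :
    j p + g * (q - p) ≤ j q := by
  induction q, hpq using Nat.le_induction with
  | base => simp
  | succ q hpq ih =>
    have := hgap q hq
    have := ih (by omega)
    rw [Nat.succ_sub hpq, Nat.mul_succ]
    omega

/-- Let `c` be submultiplicative on intervals, with `c a b ≤ N ^ (b - a)`, and with a saving
`ε (b - a)` in the exponent on each interval between two indices of the same colour.
If at most `n` colours occur from the index `p` on, the savings accumulate. -/
theorem le_rpow_of_saving_on_monochromatic {B : Type*} {N ε : ℝ} (hN : 1 ≤ N) (hε : 0 ≤ ε)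
    {c : ℕ → ℕ → ℝ} (hc0 : ∀ a b, 0 ≤ c a b)
    (hcmul : ∀ a b d, c a d ≤ c a b * c b d)
    (hcle : ∀ a b, a ≤ b → c a b ≤ N ^ ((b : ℝ) - a))
    {j : ℕ → ℕ} {L g : ℕ}
    (hgap : ∀ m, m + 1 < L + 1 → j m + g ≤ j (m + 1)) {f : ℕ → B}
    (hsave : ∀ p q, p < q → q ≤ L → f p = f q →
      c (j p) (j q) ≤ N ^ ((1 - ε) * ((j q : ℝ) - j p)))
    (n p : ℕ) (hp : p ≤ L) (hn : ((Finset.Icc p L).image f).card ≤ n) :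
    c (j p) (j L) ≤ N ^ ((j L : ℝ) - j p - ε * g * ((L : ℝ) + 1 - p - n)) := by
  have hN0 : 0 < N := by linarith
  have hlen : ∀ p q, p ≤ q → q ≤ L → (j p : ℝ) + g * ((q : ℝ) - p) ≤ j q := by
    intro p q hpq hq
    have := add_mul_le_of_gaps hgap hpq (Nat.lt_succ_of_le hq)
    rw [← Nat.cast_sub hpq]
    exact_mod_cast this
  have hsame : ∀ p q, p ≤ q → q ≤ L → f p = f q →
      c (j p) (j q) ≤ N ^ ((j q : ℝ) - j p - ε * g * ((q : ℝ) - p)) := by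
    intro p q hpq hq hf
    rcases hpq.eq_or_lt with rfl | hlt
    · simpa using hcle (j p) (j p) le_rfl
    · refine (hsave p q hlt hq hf).trans (Real.rpow_le_rpow_of_exponent_le hN ?_)
      have := mul_le_mul_of_nonneg_left (hlen p q hpq hq) hε
      linarith
  induction n generalizing p with
  | zero =>
    have : f p ∈ (Finset.Icc p L).image f :=
      Finset.mem_image_of_mem f (Finset.mem_Icc.2 ⟨le_rfl, hp⟩)
    have := Finset.card_pos.2 ⟨_, this⟩
    omega
  | succ n ih =>
    obtain ⟨q, hq, hmax⟩ := ((Finset.Icc p L).filter fun q => f q = f p).exists_maximal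
      ⟨p, by simp [hp]⟩
    simp only [Finset.mem_filter, Finset.mem_Icc] at hq hmax
    obtain ⟨⟨hpq, hqL⟩, hfq⟩ := hq
    have hεg : 0 ≤ ε * g := by positivity
    rcases hqL.eq_or_lt with rfl | hlt
    · refine (hsame p q hpq le_rfl hfq.symm).trans (Real.rpow_le_rpow_of_exponent_le hN ?_)
      have : 0 ≤ ε * g * (n : ℝ) := by positivity
      push_cast
      linarith
    · have hsub : (Finset.Icc (q + 1) L).image f ⊆ ((Finset.Icc p L).image f).erase (f p) := by
        intro y hy
        obtain ⟨m, hm, rfl⟩ := Finset.mem_image.1 hy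
        rw [Finset.mem_Icc] at hm
        refine Finset.mem_erase.2 ⟨fun hfm => ?_,
          Finset.mem_image_of_mem f (Finset.mem_Icc.2 ⟨by omega, hm.2⟩)⟩
        have := hmax ⟨⟨by omega, hm.2⟩, hfm⟩ (by omega)
        omega
      have hcard : ((Finset.Icc (q + 1) L).image f).card ≤ n := by
        have h1 := Finset.card_le_card hsub
        rw [Finset.card_erase_of_mem
          (Finset.mem_image_of_mem f (Finset.mem_Icc.2 ⟨le_rfl, hp⟩))] at h1
        omega
      have h1 := hsame p q hpq hqL hfq.symm
      have h2 := hcle (j q) (j (q + 1)) (by have := hgap q (by omega); omega)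
      have h3 := ih (q + 1) hlt hcard
      calc c (j p) (j L) ≤ c (j p) (j q) * c (j q) (j L) := hcmul _ _ _
        _ ≤ c (j p) (j q) * (c (j q) (j (q + 1)) * c (j (q + 1)) (j L)) :=
            mul_le_mul_of_nonneg_left (hcmul _ _ _) (hc0 _ _)
        _ ≤ _ := mul_le_mul h1 (mul_le_mul h2 h3 (hc0 _ _) (by positivity))
            (mul_nonneg (hc0 _ _) (hc0 _ _)) (by positivity)
        _ = _ := by
            rw [← Real.rpow_add hN0, ← Real.rpow_add hN0]
            congr 1
            push_cast
            ring

/-- Let `A` be a finite alphabet with `N₀ = #A ≥ 2`, `0 < τ < 1`,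
`k = 8·N₀²·⌈2/τ⌉` and `M = 3·N₀²`. Let `0 ≤ j₁ < ⋯ < j_M` be integers with gaps at least
`2⌈2/τ⌉` and `j_M ≤ k − 2`, let `(b_m, b'_m) ∈ A × A`, and let `X` be a finite set of words
`β : Fin k → A` with `β (j_m) = b_m` and `β (j_m + 1) = b'_m` for all `β ∈ X` and all `m`,
and `#X > N₀^{(1−2τ)k}`. For `p < q`, `π_{p,q}(X)` is the image of `X` under restriction to
the positions `i` with `j_p < i ≤ j_q`. Then there exist `p₀ < q₀ ≤ M` with
`(b_{p₀}, b'_{p₀}) = (b_{q₀}, b'_{q₀})` and `#π_{p₀,q₀}(X) > N₀^{(1−10τ)(j_{q₀} − j_{p₀})}`. -/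
theorem stmt_12 {A : Type*} [Fintype A] (N₀ : ℕ) (hN₀ : N₀ = Fintype.card A)
    (hN₀2 : 2 ≤ N₀) (τ : ℝ) (hτ0 : 0 < τ) (hτ1 : τ < 1)
    (k M : ℕ) (hk : k = 8 * N₀ ^ 2 * ⌈(2 : ℝ) / τ⌉₊) (hM : M = 3 * N₀ ^ 2)
    (j : ℕ → ℕ) (b b' : ℕ → A)
    (hgap : ∀ m, m + 1 < M → j m + 2 * ⌈(2 : ℝ) / τ⌉₊ ≤ j (m + 1))
    (hlast : ∀ m, m < M → j m ≤ k - 2)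
    (X : Finset (Fin k → A))
    (hX : ∀ β ∈ X, ∀ m, m < M → ∀ i : Fin k,
      ((i : ℕ) = j m → β i = b m) ∧ ((i : ℕ) = j m + 1 → β i = b' m))
    (hcard : (N₀ : ℝ) ^ ((1 - 2 * τ) * k) < (X.card : ℝ)) :
    ∃ p₀ q₀ : ℕ, p₀ < q₀ ∧ q₀ < M ∧ b p₀ = b q₀ ∧ b' p₀ = b' q₀ ∧
      (N₀ : ℝ) ^ ((1 - 10 * τ) * ((j q₀ : ℝ) - (j p₀ : ℝ))) <
        ((X.image fun β => fun i : {i : Fin k // j p₀ < (i : ℕ) ∧ (i : ℕ) ≤ j q₀} =>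
          β i.1).card : ℝ) := by
  by_contra! hcon
  set T := ⌈(2 : ℝ) / τ⌉₊ with hT
  have hT1 : 1 ≤ T := Nat.ceil_pos.2 (by positivity)
  have : Nonempty A := Fintype.card_pos_iff.1 (by omega)
  have hN1 : (1 : ℝ) ≤ N₀ := by exact_mod_cast (by omega : 1 ≤ N₀)
  have hN0 : (0 : ℝ) < N₀ := by linarith
  have hsq : 1 ≤ N₀ ^ 2 := Nat.one_le_pow _ _ (by omega)
  have hk2 : 2 ≤ k := by
    rw [hk]
    nlinarith
  obtain ⟨L, hL⟩ : ∃ L, M = L + 1 := ⟨M - 1, by omega⟩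
  have hjk : j L + 2 ≤ k := by
    have := hlast L (by omega)
    omega
  have hbound : ∀ (P : Fin k → Prop) (a d : ℕ), a ≤ d →
      (∀ i, P i → a ≤ (i : ℕ) ∧ (i : ℕ) < d) →
      (restrictionCount X P : ℝ) ≤ (N₀ : ℝ) ^ ((d : ℝ) - a) := by
    intro P a d had h
    have := restrictionCount_le_pow X h
    rw [← Nat.cast_sub had, Real.rpow_natCast, hN₀]
    exact_mod_cast this
  have hmain := le_rpow_of_saving_on_monochromatic (ε := 10 * τ) hN1 (by positivity)
    (c := fun a d => (restrictionCount X fun i => a < (i : ℕ) ∧ (i : ℕ) ≤ d : ℝ))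
    (fun a d => Nat.cast_nonneg _)
    (fun a m d => by
      exact_mod_cast restrictionCount_le_mul X fun i hi => by omega)
    (fun a d had => by
      have := hbound (fun i => a < (i : ℕ) ∧ (i : ℕ) ≤ d) (a + 1) (d + 1) (by omega)
        fun i hi => by omega
      simpa using this)
    (L := L) (fun m hm => hgap m (by omega)) (f := fun m => (b m, b' m))
    (fun p q hpq hq hf => by
      rw [Prod.mk.injEq] at hf
      refine le_of_eq_of_le ?_ (hcon p q hpq (by omega) hf.1 hf.2)
      simp only [restrictionCount]
      congr!)
    (N₀ ^ 2) 0 (Nat.zero_le _)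
    ((Finset.card_le_univ _).trans (by rw [Fintype.card_prod, ← hN₀, sq]))
  have hj0L : j 0 ≤ j L := by
    have := add_mul_le_of_gaps hgap (Nat.zero_le L) (by omega)
    omega
  have hlow := hbound (fun i => (i : ℕ) ≤ j 0) 0 (j 0 + 1) (by omega) fun i hi => by omega
  have hhigh := hbound (fun i => j L < (i : ℕ)) (j L + 1) k (by omega)
    fun i hi => ⟨hi, i.2⟩
  have hX1 : X.card ≤ restrictionCount X (fun i => (i : ℕ) ≤ j 0) *
      (restrictionCount X (fun i => j 0 < (i : ℕ) ∧ (i : ℕ) ≤ j L) *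
        restrictionCount X fun i => j L < (i : ℕ)) :=
    (card_le_restrictionCount X (P := fun _ => True) fun _ => trivial).trans <|
      (restrictionCount_le_mul X (R := fun i => j 0 < (i : ℕ))
        fun i _ => le_or_gt _ _).trans <|
      Nat.mul_le_mul_left _ (restrictionCount_le_mul X fun i hi => by omega)
  refine hcard.not_ge ((Nat.cast_le (α := ℝ).2 hX1).trans ?_)
  push_cast
  refine (mul_le_mul hlow (mul_le_mul hmain hhigh (by positivity) (by positivity))
    (by positivity) (by positivity)).trans ?_
  rw [← Real.rpow_add hN0, ← Real.rpow_add hN0]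
  refine Real.rpow_le_rpow_of_exponent_le hN1 ?_
  have hkR : (k : ℝ) = 8 * (N₀ : ℝ) ^ 2 * T := by exact_mod_cast hk
  have hLR : (L : ℝ) + 1 = 3 * (N₀ : ℝ) ^ 2 := by exact_mod_cast (hL.symm.trans hM)
  have hτk : 0 ≤ τ * ((N₀ : ℝ) ^ 2 * T) := by positivity
  rw [hLR]
  push_cast
  rw [hkR]
  linarith
end

section
/- For all integers n, m ≥ 1, one has #C(n + m) ≤ (#A)^{c₃} · #C(n) · #C(m). -/
/-- A nonempty word `α` *crosses scale* `r` if `w α ≤ e^{−r}` and, in addition, either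
`|α| = 1` or `w α' > e^{−r}` where `α'` is `α` with its last letter removed. -/
def Crosses {A : Type*} (w : List A → ℝ) (r : ℕ) (α : List A) : Prop :=
  α ≠ [] ∧ w α ≤ Real.exp (-(r : ℝ)) ∧
    (α.length = 1 ∨ Real.exp (-(r : ℝ)) < w α.dropLast)

/-- `CrossSet w F r` is the set `C(r)` of nonempty finite words that cross scale `r` and are
prefixes of some sequence `θ ∈ F`. -/
def CrossSet {A : Type*} (w : List A → ℝ) (F : Set (ℕ → A)) (r : ℕ) : Set (List A) :=
  {α | Crosses w r α ∧ ∃ θ ∈ F, ∃ n : ℕ, α = List.ofFn fun i : Fin n => θ i}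

theorem ofFn_prefix_add {A : Type*} (θ : ℕ → A) (a b : ℕ) :
    (List.ofFn fun i : Fin (a + b) => θ i) =
      (List.ofFn fun i : Fin a => θ i) ++ List.ofFn fun i : Fin b => θ (i + a) := by
  rw [List.ofFn_add]
  simp [add_comm]

theorem ofFn_prefix_of_le {A : Type*} (θ : ℕ → A) {a b : ℕ} (h : a ≤ b) :
    (List.ofFn fun i : Fin a => θ i) <+: List.ofFn fun i : Fin b => θ i := by
  obtain ⟨d, rfl⟩ := Nat.exists_eq_add_of_le h
  rw [ofFn_prefix_add]
  exact List.prefix_append _ _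

theorem weight_le_of_prefix {A : Type*} {w : List A → ℝ}
    (hmono : ∀ α β : List A, α ≠ [] → β ≠ [] → w (α ++ β) ≤ w α)
    {α β : List A} (hα : α ≠ []) (h : α <+: β) : w β ≤ w α := by
  obtain ⟨γ, rfl⟩ := h
  by_cases hγ : γ = []
  · simp [hγ]
  · exact hmono α γ hα hγ

/-- A word crossing scale `r` is a prefix of every comparable word of weight at most `e^{-r}`. -/
theorem Crosses.prefix_of_weight_le {A : Type*} {w : List A → ℝ}
    (hmono : ∀ α β : List A, α ≠ [] → β ≠ [] → w (α ++ β) ≤ w α)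
    {r : ℕ} {γ δ η : List A} (hγ : Crosses w r γ) (hδ : δ ≠ [])
    (hw : w δ ≤ Real.exp (-(r : ℝ))) (hγη : γ <+: η) (hδη : δ <+: η) : γ <+: δ := by
  rcases le_or_gt γ.length δ.length with h | h
  · exact List.prefix_of_prefix_length_le hγη hδη h
  · exfalso
    have hpos : 0 < δ.length := List.length_pos_iff.2 hδ
    have hdrop : δ <+: γ.dropLast :=
      List.prefix_of_prefix_length_le hδη ((List.dropLast_prefix γ).trans hγη)
        (by rw [List.length_dropLast]; omega)
    have hle := weight_le_of_prefix hmono hδ hdrop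
    rcases hγ.2.2 with h1 | h1
    · omega
    · linarith

theorem Crosses.eq_of_prefix {A : Type*} {w : List A → ℝ}
    (hmono : ∀ α β : List A, α ≠ [] → β ≠ [] → w (α ++ β) ≤ w α)
    {r : ℕ} {γ δ η : List A} (hγ : Crosses w r γ) (hδ : Crosses w r δ)
    (hγη : γ <+: η) (hδη : δ <+: η) : γ = δ :=
  (hγ.prefix_of_weight_le hmono hδ.1 hδ.2.1 hγη hδη).eq_of_length_le
    (hδ.prefix_of_weight_le hmono hγ.1 hγ.2.1 hδη hγη).length_le

theorem exists_weight_le_of_length_ge {A : Type*} {w : List A → ℝ} {C μ : ℝ} (hμ : 1 < μ)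
    (hdecay : ∀ α : List A, α ≠ [] → w α ≤ C * μ ^ (-(α.length : ℤ))) {ε : ℝ} (hε : 0 < ε) :
    ∃ N : ℕ, ∀ α : List A, α ≠ [] → N ≤ α.length → w α ≤ ε := by
  have ht : Filter.Tendsto (fun k : ℕ => C * (μ⁻¹) ^ k) Filter.atTop (nhds (C * 0)) :=
    (tendsto_pow_atTop_nhds_zero_of_lt_one (by positivity) (inv_lt_one_of_one_lt₀ hμ)).const_mul C
  rw [mul_zero] at ht
  obtain ⟨N, hN⟩ := Filter.eventually_atTop.1 (ht.eventually (eventually_le_nhds hε))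
  refine ⟨N, fun α hα h => (hdecay α hα).trans ?_⟩
  simpa using hN α.length h

theorem crossSet_finite {A : Type*} [Finite A] {w : List A → ℝ} {C μ : ℝ} (hμ : 1 < μ)
    (hdecay : ∀ α : List A, α ≠ [] → w α ≤ C * μ ^ (-(α.length : ℤ)))
    (F : Set (ℕ → A)) (r : ℕ) : (CrossSet w F r).Finite := by
  obtain ⟨N, hN⟩ := exists_weight_le_of_length_ge hμ hdecay (Real.exp_pos (-(r : ℝ)))
  refine (List.finite_length_le A (N + 1)).subset ?_
  rintro α ⟨⟨hα, -, h⟩, -⟩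
  simp only [Set.mem_ofPred_eq]
  by_contra! hlen
  have hl : α.dropLast.length = α.length - 1 := List.length_dropLast
  rcases h with h | h
  · omega
  · have := hN α.dropLast (List.ne_nil_of_length_pos (by omega)) (by omega)
    linarith

theorem exists_ofFn_mem_crossSet {A : Type*} {w : List A → ℝ} {C μ : ℝ} (hμ : 1 < μ)
    (hdecay : ∀ α : List A, α ≠ [] → w α ≤ C * μ ^ (-(α.length : ℤ)))
    {F : Set (ℕ → A)} {θ : ℕ → A} (hθ : θ ∈ F) (r : ℕ) :
    ∃ k : ℕ, (List.ofFn fun i : Fin k => θ i) ∈ CrossSet w F r := by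
  classical
  obtain ⟨N, hN⟩ := exists_weight_le_of_length_ge hμ hdecay (Real.exp_pos (-(r : ℝ)))
  have hex : ∃ k : ℕ, w (List.ofFn fun i : Fin (k + 1) => θ i) ≤ Real.exp (-(r : ℝ)) :=
    ⟨N, hN _ (List.ne_nil_of_length_pos (by simp)) (by simp)⟩
  refine ⟨Nat.find hex + 1,
    ⟨List.ne_nil_of_length_pos (by simp), Nat.find_spec hex, ?_⟩, θ, hθ, _, rfl⟩
  rcases Nat.eq_zero_or_pos (Nat.find hex) with h | h
  · left
    rw [List.length_ofFn, h]
  · right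
    have hmin := Nat.find_min hex (m := Nat.find hex - 1) (by omega)
    rw [Nat.sub_add_cancel h, not_le] at hmin
    rw [ofFn_prefix_add]
    simpa using hmin

theorem shift_iterate_mem {A : Type*} {F : Set (ℕ → A)}
    (hshift : ∀ θ ∈ F, (fun n => θ (n + 1)) ∈ F) {θ : ℕ → A} (hθ : θ ∈ F) (k : ℕ) :
    (fun n => θ (n + k)) ∈ F := by
  induction k with
  | zero => exact hθ
  | succ k ih => simpa [add_assoc, add_comm 1 k] using hshift _ ih

/-- Appending `k ≥ (2c₁ + log C) / log μ` letters absorbs the two submultiplicativity constants. -/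
theorem weight_append_append_le {A : Type*} {c₁ C μ : ℝ} (hc₁ : 0 ≤ c₁) (hC : 1 ≤ C) (hμ : 1 < μ)
    {w : List A → ℝ} (hpos : ∀ α : List A, α ≠ [] → 0 < w α)
    (hsub : ∀ α β : List A, α ≠ [] → β ≠ [] → w (α ++ β) ≤ Real.exp c₁ * (w α * w β))
    (hdecay : ∀ α : List A, α ≠ [] → w α ≤ C * μ ^ (-(α.length : ℤ)))
    {α β κ : List A} (hα : α ≠ []) (hβ : β ≠ [])
    (hκ : (2 * c₁ + Real.log C) / Real.log μ ≤ κ.length) :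
    w (α ++ β ++ κ) ≤ w α * w β := by
  have hlogμ : 0 < Real.log μ := Real.log_pos hμ
  have hlogC : 0 ≤ Real.log C := Real.log_nonneg hC
  have hαβ : 0 < w α * w β := mul_pos (hpos α hα) (hpos β hβ)
  rw [div_le_iff₀ hlogμ] at hκ
  by_cases hnil : κ = []
  · have hc : c₁ = 0 := by
      simp only [hnil, List.length_nil, Nat.cast_zero, zero_mul] at hκ
      linarith
    simpa [hnil, hc] using hsub α β hα hβ
  · have hconst : Real.exp c₁ * Real.exp c₁ * (C * μ ^ (-(κ.length : ℤ))) ≤ 1 := by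
      have h1 : C * μ ^ (-(κ.length : ℤ)) = Real.exp (Real.log C - κ.length * Real.log μ) := by
        rw [Real.exp_sub, Real.exp_log (by linarith), Real.exp_nat_mul,
          Real.exp_log (by linarith), zpow_neg, zpow_natCast, div_eq_mul_inv]
      rw [h1, ← Real.exp_add, ← Real.exp_add, Real.exp_le_one_iff]
      linarith
    calc w (α ++ β ++ κ)
        ≤ Real.exp c₁ * (w (α ++ β) * w κ) := hsub _ _ (by simp [hα]) hnil
      _ ≤ Real.exp c₁ * (Real.exp c₁ * (w α * w β) * (C * μ ^ (-(κ.length : ℤ)))) := by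
          gcongr
          · exact (hpos κ hnil).le
          · exact hsub α β hα hβ
          · exact hdecay κ hnil
      _ = Real.exp c₁ * Real.exp c₁ * (C * μ ^ (-(κ.length : ℤ))) * (w α * w β) := by ring
      _ ≤ 1 * (w α * w β) := by gcongr
      _ = w α * w β := one_mul _

/-- Fix a finite nonempty alphabet `A`, reals `c₁ ≥ 0`, `C ≥ 1`, `μ > 1`,
and `w` a positive weight on nonempty words with `w (αβ) ≤ e^{c₁}·w α·w β`, `w (αβ) ≤ w α`
and `w α ≤ C·μ^{−|α|}`. Let `F` be a nonempty set of sequences `θ : ℕ → A` closed under the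
one-sided shift, let `C(r) := CrossSet w F r`, and `c₃ := ⌈(2c₁ + log C)/log μ⌉`. Then for
all `n, m ≥ 1` one has `#C(n + m) ≤ (#A)^{c₃} · #C(n) · #C(m)`. -/
theorem stmt_13 {A : Type*} [Fintype A] [Nonempty A]
    (c₁ C μ : ℝ) (hc₁ : 0 ≤ c₁) (hC : 1 ≤ C) (hμ : 1 < μ)
    (w : List A → ℝ)
    (hpos : ∀ α : List A, α ≠ [] → 0 < w α)
    (hsub : ∀ α β : List A, α ≠ [] → β ≠ [] → w (α ++ β) ≤ Real.exp c₁ * (w α * w β))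
    (hmono : ∀ α β : List A, α ≠ [] → β ≠ [] → w (α ++ β) ≤ w α)
    (hdecay : ∀ α : List A, α ≠ [] → w α ≤ C * μ ^ (-(α.length : ℤ)))
    (F : Set (ℕ → A)) (hF : F.Nonempty)
    (hshift : ∀ θ ∈ F, (fun n => θ (n + 1)) ∈ F)
    (c₃ : ℕ) (hc₃ : c₃ = ⌈(2 * c₁ + Real.log C) / Real.log μ⌉₊)
    (n m : ℕ) (hn : 1 ≤ n) (hm : 1 ≤ m) :
    (CrossSet w F (n + m)).ncard ≤
      Fintype.card A ^ c₃ * (CrossSet w F n).ncard * (CrossSet w F m).ncard := by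
  have key : ∀ γ : List A, ∃ p : List A × List A × (Fin c₃ → A), γ ∈ CrossSet w F (n + m) →
      p.1 ∈ CrossSet w F n ∧ p.2.1 ∈ CrossSet w F m ∧
        γ <+: p.1 ++ p.2.1 ++ List.ofFn p.2.2 := by
    intro γ
    by_cases hγ : γ ∈ CrossSet w F (n + m)
    · obtain ⟨hcross, θ, hθ, k, hk⟩ := hγ
      obtain ⟨a, ha⟩ := exists_ofFn_mem_crossSet hμ hdecay hθ n
      obtain ⟨b, hb⟩ :=
        exists_ofFn_mem_crossSet hμ hdecay (shift_iterate_mem hshift hθ a) m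
      refine ⟨(List.ofFn fun i : Fin a => θ i, List.ofFn fun i : Fin b => θ (i + a),
        fun i => θ (i + (a + b))), fun _ => ⟨ha, hb, ?_⟩⟩
      dsimp only
      have hsplit := ofFn_prefix_add θ (a + b) c₃
      rw [ofFn_prefix_add θ a b] at hsplit
      refine hcross.prefix_of_weight_le hmono (η := List.ofFn
        fun i : Fin (k + (a + b + c₃)) => θ i)
        (List.append_ne_nil_of_left_ne_nil (List.append_ne_nil_of_left_ne_nil ha.1.1 _) _)
        ?_ ?_ ?_
      · refine (weight_append_append_le hc₁ hC hμ hpos hsub hdecay ha.1.1 hb.1.1 ?_).trans ?_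
        · rw [List.length_ofFn, hc₃]
          exact Nat.le_ceil _
        · rw [Nat.cast_add, neg_add, Real.exp_add]
          exact mul_le_mul ha.1.2.1 hb.1.2.1 (hpos _ hb.1.1).le (Real.exp_pos _).le
      · rw [hk]
        exact ofFn_prefix_of_le θ (by omega)
      · rw [← hsplit]
        exact ofFn_prefix_of_le θ (by omega)
    · exact ⟨([], [], fun _ => Classical.arbitrary A), fun h => absurd h hγ⟩
  choose f hf using key
  have hfin : (CrossSet w F n ×ˢ CrossSet w F m ×ˢ (Set.univ : Set (Fin c₃ → A))).Finite :=
    (crossSet_finite hμ hdecay F n).prod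
      ((crossSet_finite hμ hdecay F m).prod Set.finite_univ)
  have hle := Set.ncard_le_ncard_of_injOn (s := CrossSet w F (n + m))
    (t := CrossSet w F n ×ˢ CrossSet w F m ×ˢ (Set.univ : Set (Fin c₃ → A))) f
    (fun γ hγ => ⟨(hf γ hγ).1, (hf γ hγ).2.1, Set.mem_univ _⟩)
    (fun γ hγ δ hδ h => hγ.1.eq_of_prefix hmono hδ.1 (hf γ hγ).2.2
      (h ▸ (hf δ hδ).2.2)) hfin
  rw [Set.ncard_prod, Set.ncard_prod, Set.ncard_univ, Nat.card_eq_fintype_card,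
    Fintype.card_fun, Fintype.card_fin] at hle
  calc _ ≤ _ := hle
    _ = _ := by ring
end

section
/- For every r ≥ 1 the set C(r) is finite and nonempty, the sequence r ↦ (log #C(r))/r converges as r → ∞, and its limit equals inf_{r ≥ 1} (log((#A)^{c₃} · #C(r)))/r. -/
section CrossingWords

variable {A : Type*}

/-- The prefix of length `n` of the sequence `θ`. -/
def seqPrefix (θ : ℕ → A) (n : ℕ) : List A := List.ofFn fun i : Fin n => θ i

lemma length_seqPrefix (θ : ℕ → A) (n : ℕ) : (seqPrefix θ n).length = n := by
  simp [seqPrefix]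

lemma seqPrefix_ne_nil (θ : ℕ → A) {n : ℕ} (hn : 1 ≤ n) : seqPrefix θ n ≠ [] := by
  rw [← List.length_pos_iff, length_seqPrefix]
  exact hn

lemma seqPrefix_add (θ : ℕ → A) (m n : ℕ) :
    seqPrefix θ (m + n) = seqPrefix θ m ++ seqPrefix (fun i => θ (i + m)) n := by
  simp [seqPrefix, List.ofFn_add, add_comm]

lemma dropLast_seqPrefix_succ (θ : ℕ → A) (n : ℕ) :
    (seqPrefix θ (n + 1)).dropLast = seqPrefix θ n := by
  rw [seqPrefix_add, List.dropLast_append_of_ne_nil (seqPrefix_ne_nil _ le_rfl)]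
  simp [seqPrefix]

lemma shift_mem {F : Set (ℕ → A)} (hshift : ∀ θ ∈ F, (fun n => θ (n + 1)) ∈ F)
    {θ : ℕ → A} (hθ : θ ∈ F) (m : ℕ) : (fun n => θ (n + m)) ∈ F := by
  induction m with
  | zero => exact hθ
  | succ m ih =>
    have h := hshift _ ih
    simpa [add_assoc, add_comm 1 m] using h

variable {w : List A → ℝ}

lemma weight_seqPrefix_le
    (hmono : ∀ α β : List A, α ≠ [] → β ≠ [] → w (α ++ β) ≤ w α)
    (θ : ℕ → A) {m n : ℕ} (hm : 1 ≤ m) (hmn : m ≤ n) :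
    w (seqPrefix θ n) ≤ w (seqPrefix θ m) := by
  obtain ⟨k, rfl⟩ := Nat.exists_eq_add_of_le hmn
  rcases Nat.eq_zero_or_pos k with rfl | hk
  · exact le_rfl
  · rw [seqPrefix_add]
    exact hmono _ _ (seqPrefix_ne_nil _ hm) (seqPrefix_ne_nil _ hk)

lemma Crosses.le_of_weight_le
    (hmono : ∀ α β : List A, α ≠ [] → β ≠ [] → w (α ++ β) ≤ w α)
    {θ : ℕ → A} {r m n : ℕ} (h : Crosses w r (seqPrefix θ n)) (hm : 1 ≤ m)
    (hle : w (seqPrefix θ m) ≤ Real.exp (-(r : ℝ))) : n ≤ m := by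
  by_contra! hlt
  obtain ⟨k, rfl⟩ : ∃ k, n = k + 1 := ⟨n - 1, by omega⟩
  rcases h.2.2 with h1 | h1
  · rw [length_seqPrefix] at h1
    omega
  · rw [dropLast_seqPrefix_succ] at h1
    exact absurd ((weight_seqPrefix_le hmono θ hm (by omega)).trans hle) (not_le.2 h1)

lemma Crosses.eq_of_prefix_s14
    (hmono : ∀ α β : List A, α ≠ [] → β ≠ [] → w (α ++ β) ≤ w α)
    {r : ℕ} {α β : List A} (hα : Crosses w r α) (hβ : Crosses w r β) (h : α <+: β) : α = β := by
  obtain ⟨t, rfl⟩ := h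
  by_contra hne
  have ht : t ≠ [] := by
    rintro rfl
    simp at hne
  rcases hβ.2.2 with h1 | h1
  · have h2 := List.length_pos_iff.2 hα.1
    have h3 := List.length_pos_iff.2 ht
    rw [List.length_append] at h1
    omega
  · rw [List.dropLast_append_of_ne_nil ht] at h1
    refine absurd hα.2.1 (not_le.2 (h1.trans_le ?_))
    by_cases hd : t.dropLast = []
    · simp [hd]
    · exact hmono _ _ hα.1 hd

lemma Crosses.eq_of_common_extension
    (hmono : ∀ α β : List A, α ≠ [] → β ≠ [] → w (α ++ β) ≤ w α)
    {r : ℕ} {α β l : List A} (hα : Crosses w r α) (hβ : Crosses w r β)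
    (h₁ : α <+: l) (h₂ : β <+: l) : α = β := by
  rcases le_total α.length β.length with h | h
  · exact hα.eq_of_prefix_s14 hmono hβ (List.prefix_of_prefix_length_le h₁ h₂ h)
  · exact (hβ.eq_of_prefix_s14 hmono hα (List.prefix_of_prefix_length_le h₂ h₁ h)).symm

variable {C μ : ℝ}

lemma exists_decay_lt (hμ : 1 < μ) (r : ℕ) :
    ∃ N : ℕ, ∀ n, N ≤ n → C * μ ^ (-(n : ℤ)) < Real.exp (-(r : ℝ)) := by
  have h : Filter.Tendsto (fun n : ℕ => C * μ ^ (-(n : ℤ))) Filter.atTop (nhds 0) := by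
    have h1 := (tendsto_pow_atTop_nhds_zero_of_lt_one (r := μ⁻¹) (by positivity)
      (inv_lt_one_of_one_lt₀ hμ)).const_mul C
    simpa using h1
  exact Filter.eventually_atTop.1 (h.eventually_lt_const (Real.exp_pos _))

lemma exists_crosses_seqPrefix (hμ : 1 < μ)
    (hdecay : ∀ α : List A, α ≠ [] → w α ≤ C * μ ^ (-(α.length : ℤ)))
    (θ : ℕ → A) (r : ℕ) : ∃ n, 1 ≤ n ∧ Crosses w r (seqPrefix θ n) := by
  classical
  have hex : ∃ n, 1 ≤ n ∧ w (seqPrefix θ n) ≤ Real.exp (-(r : ℝ)) := by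
    obtain ⟨N, hN⟩ := exists_decay_lt (C := C) hμ r
    refine ⟨N + 1, by omega, ?_⟩
    have h := hdecay (seqPrefix θ (N + 1)) (seqPrefix_ne_nil _ (by omega))
    rw [length_seqPrefix] at h
    exact h.trans (hN _ (by omega)).le
  obtain ⟨h1, h2⟩ := Nat.find_spec hex
  have hmin := fun m => Nat.find_min hex (m := m)
  generalize Nat.find hex = n at h1 h2 hmin
  refine ⟨n, h1, seqPrefix_ne_nil _ h1, h2, ?_⟩
  obtain ⟨k, rfl⟩ : ∃ k, n = k + 1 := ⟨n - 1, by omega⟩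
  rw [length_seqPrefix, dropLast_seqPrefix_succ]
  rcases Nat.eq_zero_or_pos k with rfl | hk
  · exact Or.inl rfl
  · right
    by_contra! hle
    exact hmin k (by omega) ⟨hk, hle⟩

lemma CrossSet.nonempty (hμ : 1 < μ)
    (hdecay : ∀ α : List A, α ≠ [] → w α ≤ C * μ ^ (-(α.length : ℤ)))
    {F : Set (ℕ → A)} (hF : F.Nonempty) (r : ℕ) : (CrossSet w F r).Nonempty := by
  obtain ⟨θ, hθ⟩ := hF
  obtain ⟨n, -, hn⟩ := exists_crosses_seqPrefix hμ hdecay θ r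
  exact ⟨_, hn, θ, hθ, n, rfl⟩

lemma CrossSet.finite [Finite A] (hμ : 1 < μ)
    (hdecay : ∀ α : List A, α ≠ [] → w α ≤ C * μ ^ (-(α.length : ℤ)))
    (F : Set (ℕ → A)) (r : ℕ) : (CrossSet w F r).Finite := by
  obtain ⟨N, hN⟩ := exists_decay_lt (C := C) hμ r
  refine (List.finite_length_le A (N + 1)).subset fun α hα => ?_
  obtain ⟨⟨-, -, h⟩, -⟩ := hα
  change α.length ≤ N + 1
  by_contra! hlt
  rcases h with h | h
  · omega
  · have hne : α.dropLast ≠ [] := by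
      rw [← List.length_pos_iff, List.length_dropLast]
      omega
    refine absurd ((hdecay _ hne).trans_lt (hN _ ?_)) h.not_gt
    rw [List.length_dropLast]
    omega

lemma exp_mul_le_pow_ceil {c : ℝ} (hC : 0 < C) (hμ : 1 < μ) :
    Real.exp c * C ≤ μ ^ ⌈(c + Real.log C) / Real.log μ⌉₊ := by
  have hμ0 : 0 < μ := by linarith
  have h := Nat.le_ceil ((c + Real.log C) / Real.log μ)
  rw [div_le_iff₀ (Real.log_pos hμ)] at h
  calc Real.exp c * C = Real.exp (c + Real.log C) := by rw [Real.exp_add, Real.exp_log hC]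
    _ ≤ Real.exp (⌈(c + Real.log C) / Real.log μ⌉₊ * Real.log μ) := Real.exp_le_exp.2 h
    _ = _ := by rw [Real.exp_nat_mul, Real.exp_log hμ0]

lemma weight_triple_le {c₁ : ℝ} {k r s a b : ℕ} (hc₁ : 0 ≤ c₁) (hC : 1 ≤ C) (hμ : 1 < μ)
    (hpos : ∀ α : List A, α ≠ [] → 0 < w α)
    (hsub : ∀ α β : List A, α ≠ [] → β ≠ [] → w (α ++ β) ≤ Real.exp c₁ * (w α * w β))
    (hdecay : ∀ α : List A, α ≠ [] → w α ≤ C * μ ^ (-(α.length : ℤ)))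
    (hk : Real.exp (2 * c₁) * C ≤ μ ^ k) (θ : ℕ → A) (ha : 1 ≤ a) (hb : 1 ≤ b)
    (hwa : w (seqPrefix θ a) ≤ Real.exp (-(r : ℝ)))
    (hwb : w (seqPrefix (fun i => θ (i + a)) b) ≤ Real.exp (-(s : ℝ))) :
    w (seqPrefix θ (a + b + k)) ≤ Real.exp (-((r + s : ℕ) : ℝ)) := by
  have hrs : Real.exp (-((r + s : ℕ) : ℝ)) = Real.exp (-(r : ℝ)) * Real.exp (-(s : ℝ)) := by
    rw [← Real.exp_add]
    push_cast
    ring_nf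
  have hab : w (seqPrefix θ (a + b)) ≤ Real.exp c₁ * Real.exp (-((r + s : ℕ) : ℝ)) := by
    rw [seqPrefix_add, hrs]
    refine (hsub _ _ (seqPrefix_ne_nil _ ha) (seqPrefix_ne_nil _ hb)).trans ?_
    have := (hpos _ (seqPrefix_ne_nil (fun i => θ (i + a)) hb)).le
    gcongr
  have h2 : Real.exp (2 * c₁) = Real.exp c₁ * Real.exp c₁ := by
    rw [← Real.exp_add, two_mul]
  have h1 : 1 ≤ Real.exp c₁ := Real.one_le_exp hc₁
  rcases Nat.eq_zero_or_pos k with rfl | hk0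
  · rw [pow_zero, h2] at hk
    refine hab.trans (mul_le_of_le_one_left (Real.exp_pos _).le ?_)
    nlinarith [mul_le_mul h1 hC zero_le_one (by positivity)]
  · rw [seqPrefix_add θ (a + b) k]
    have hne := seqPrefix_ne_nil (fun i => θ (i + (a + b))) hk0
    have hd := hdecay _ hne
    rw [length_seqPrefix, zpow_neg, zpow_natCast] at hd
    have hμk : 0 < μ ^ k := by positivity
    calc _ ≤ Real.exp c₁ * (w (seqPrefix θ (a + b)) * w (seqPrefix _ k)) :=
          hsub _ _ (seqPrefix_ne_nil _ (by omega)) hne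
      _ ≤ Real.exp c₁ * (Real.exp c₁ * Real.exp (-((r + s : ℕ) : ℝ)) * (C * (μ ^ k)⁻¹)) := by
          have := (hpos _ hne).le
          gcongr
      _ = (Real.exp (2 * c₁) * C) * (μ ^ k)⁻¹ * Real.exp (-((r + s : ℕ) : ℝ)) := by
          rw [h2]
          ring
      _ ≤ μ ^ k * (μ ^ k)⁻¹ * Real.exp (-((r + s : ℕ) : ℝ)) := by gcongr
      _ = _ := by rw [mul_inv_cancel₀ hμk.ne', one_mul]

lemma CrossSet.ncard_add_le [Fintype A] [Nonempty A] {c₁ : ℝ} {k : ℕ}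
    (hc₁ : 0 ≤ c₁) (hC : 1 ≤ C) (hμ : 1 < μ)
    (hpos : ∀ α : List A, α ≠ [] → 0 < w α)
    (hsub : ∀ α β : List A, α ≠ [] → β ≠ [] → w (α ++ β) ≤ Real.exp c₁ * (w α * w β))
    (hmono : ∀ α β : List A, α ≠ [] → β ≠ [] → w (α ++ β) ≤ w α)
    (hdecay : ∀ α : List A, α ≠ [] → w α ≤ C * μ ^ (-(α.length : ℤ)))
    {F : Set (ℕ → A)} (hshift : ∀ θ ∈ F, (fun n => θ (n + 1)) ∈ F)
    (hk : Real.exp (2 * c₁) * C ≤ μ ^ k) (r s : ℕ) :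
    (CrossSet w F (r + s)).ncard ≤
      Fintype.card A ^ k * ((CrossSet w F r).ncard * (CrossSet w F s).ncard) := by
  have key : ∀ γ ∈ CrossSet w F (r + s), ∃ p : (Fin k → A) × List A × List A,
      p ∈ (Set.univ : Set (Fin k → A)) ×ˢ (CrossSet w F r ×ˢ CrossSet w F s) ∧
        γ <+: p.2.1 ++ p.2.2 ++ List.ofFn p.1 := by
    rintro γ ⟨hγ, θ, hθ, n, rfl⟩
    obtain ⟨a, ha, hca⟩ := exists_crosses_seqPrefix hμ hdecay θ r
    obtain ⟨b, hb, hcb⟩ := exists_crosses_seqPrefix hμ hdecay (fun i => θ (i + a)) s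
    have hn : n ≤ a + b + k := hγ.le_of_weight_le hmono (by omega)
      (weight_triple_le hc₁ hC hμ hpos hsub hdecay hk θ ha hb hca.2.1 hcb.2.1)
    refine ⟨(fun i => θ (i + (a + b)), seqPrefix θ a, seqPrefix (fun i => θ (i + a)) b),
      ⟨Set.mem_univ _, ⟨hca, θ, hθ, a, rfl⟩, hcb, _, shift_mem hshift hθ a, b, rfl⟩, ?_⟩
    obtain ⟨m, hm⟩ := Nat.exists_eq_add_of_le hn
    refine ⟨seqPrefix (fun i => θ (i + n)) m, ?_⟩
    change seqPrefix θ n ++ _ =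
      seqPrefix θ a ++ seqPrefix (fun i => θ (i + a)) b ++ seqPrefix (fun i => θ (i + (a + b))) k
    rw [← seqPrefix_add, ← seqPrefix_add, ← seqPrefix_add, hm]
  choose! f hf hpre using key
  have hle := Set.ncard_le_ncard_of_injOn f hf
    (fun γ hγ γ' hγ' h => hγ.1.eq_of_common_extension hmono hγ'.1 (hpre γ hγ) (h ▸ hpre γ' hγ'))
    (Set.finite_univ.prod ((CrossSet.finite hμ hdecay F r).prod (CrossSet.finite hμ hdecay F s)))
  simpa [Set.ncard_prod, Set.ncard_univ, Nat.card_eq_fintype_card] using hle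

end CrossingWords

/-- In the setting of Statement 13 (positive weight `w` which is
submultiplicative up to `e^{c₁}`, monotone under extension, and with decay `w α ≤ C·μ^{−|α|}`;
`F` a nonempty shift-invariant set of sequences; `C(r) := CrossSet w F r`;
`c₃ := ⌈(2c₁ + log C)/log μ⌉`): for every `r ≥ 1` the set `C(r)` is finite and nonempty,
the sequence `r ↦ log #C(r) / r` converges as `r → ∞`, and its limit equals
`inf_{r ≥ 1} log((#A)^{c₃} · #C(r)) / r`. -/
theorem stmt_14 {A : Type*} [Fintype A] [Nonempty A]
    (c₁ C μ : ℝ) (hc₁ : 0 ≤ c₁) (hC : 1 ≤ C) (hμ : 1 < μ)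
    (w : List A → ℝ)
    (hpos : ∀ α : List A, α ≠ [] → 0 < w α)
    (hsub : ∀ α β : List A, α ≠ [] → β ≠ [] → w (α ++ β) ≤ Real.exp c₁ * (w α * w β))
    (hmono : ∀ α β : List A, α ≠ [] → β ≠ [] → w (α ++ β) ≤ w α)
    (hdecay : ∀ α : List A, α ≠ [] → w α ≤ C * μ ^ (-(α.length : ℤ)))
    (F : Set (ℕ → A)) (hF : F.Nonempty)
    (hshift : ∀ θ ∈ F, (fun n => θ (n + 1)) ∈ F)
    (c₃ : ℕ) (hc₃ : c₃ = ⌈(2 * c₁ + Real.log C) / Real.log μ⌉₊) :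
    (∀ r : ℕ, 1 ≤ r → (CrossSet w F r).Finite ∧ (CrossSet w F r).Nonempty) ∧
    Filter.Tendsto (fun r : ℕ => Real.log ((CrossSet w F r).ncard) / r) Filter.atTop
      (nhds (⨅ r : {r : ℕ // 1 ≤ r},
        Real.log ((Fintype.card A : ℝ) ^ c₃ * ((CrossSet w F r.1).ncard : ℝ)) / (r.1 : ℝ))) := by
  have hfin := CrossSet.finite hμ hdecay F
  have hne := CrossSet.nonempty hμ hdecay hF
  refine ⟨fun r _ => ⟨hfin r, hne r⟩, ?_⟩
  have hk : Real.exp (2 * c₁) * C ≤ μ ^ c₃ := hc₃ ▸ exp_mul_le_pow_ceil (by linarith) hμ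
  have hN : ∀ r, 0 < (CrossSet w F r).ncard := fun r => (Set.ncard_pos (hfin r)).2 (hne r)
  have hA : (0 : ℝ) < (Fintype.card A : ℝ) ^ c₃ := by
    have := Fintype.card_pos (α := A)
    positivity
  set u : ℕ → ℝ := fun r =>
    Real.log ((Fintype.card A : ℝ) ^ c₃ * ((CrossSet w F r).ncard : ℝ)) with hu
  have hprod : ∀ r, 0 < (Fintype.card A : ℝ) ^ c₃ * ((CrossSet w F r).ncard : ℝ) := fun r =>
    mul_pos hA (Nat.cast_pos.2 (hN r))
  have hsubadd : Subadditive u := by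
    intro r s
    simp only [hu]
    rw [← Real.log_mul (hprod r).ne' (hprod s).ne']
    refine Real.log_le_log (hprod _) ?_
    have h : ((CrossSet w F (r + s)).ncard : ℝ) ≤ (Fintype.card A : ℝ) ^ c₃ *
        ((CrossSet w F r).ncard * (CrossSet w F s).ncard) := by
      exact_mod_cast CrossSet.ncard_add_le hc₁ hC hμ hpos hsub hmono hdecay hshift hk r s
    calc _ ≤ (Fintype.card A : ℝ) ^ c₃ * ((Fintype.card A : ℝ) ^ c₃ *
        ((CrossSet w F r).ncard * (CrossSet w F s).ncard)) := by gcongr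
      _ = _ := by ring
  have hnonneg : ∀ r, 0 ≤ u r := fun r => by
    refine Real.log_nonneg ?_
    have h : 1 ≤ Fintype.card A ^ c₃ * (CrossSet w F r).ncard :=
      Nat.mul_pos (pow_pos Fintype.card_pos _) (hN r)
    exact_mod_cast h
  have hbdd : BddBelow (Set.range fun n : ℕ => u n / n) := by
    refine ⟨0, ?_⟩
    rintro _ ⟨n, rfl⟩
    exact div_nonneg (hnonneg n) n.cast_nonneg
  have hlim : hsubadd.lim = ⨅ r : {r : ℕ // 1 ≤ r}, u r.1 / (r.1 : ℝ) := by
    rw [Subadditive.lim, sInf_image']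
    rfl
  have h := (hsubadd.tendsto_lim hbdd).sub
    (tendsto_const_div_atTop_nhds_zero_nat (Real.log ((Fintype.card A : ℝ) ^ c₃)))
  rw [sub_zero, hlim] at h
  refine h.congr fun r => ?_
  simp only [hu]
  rw [Real.log_mul hA.ne' (Nat.cast_pos.2 (hN r)).ne']
  ring
end
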